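/- Let K = Sp(n) with n ≥ 6 and let H = Sp(1)ⁿ ⊂ Sp(n) be the subgroup of diagonal matrices with unit quaternion entries. If G is a closed connected subgroup of K such that G × H acts on K with cohomogeneity at most one by left and right translations, then G = K. -/

import Mathlib

/-! Statement 10: if `K = Sp n` (`n ≥ 6`), `H = Sp(1)ⁿ` the diagonal subgroup, and `G`
is a closed connected subgroup of `K` such that `G × H` acts on `K` with cohomogeneity
at most one by left and right translations, then `G = K`. -/
open Module

noncomputable section

/-- The tangent space at `x` of a set `S` of matrices: the span of all entrywise
velocities at `0` of curves in `S` passing through `x`. -/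
def matTangentAt {m n R : Type*} [NormedAddCommGroup R] [NormedSpace ℝ R]
    (S : Set (Matrix m n R)) (x : Matrix m n R) : Submodule ℝ (Matrix m n R) :=
  Submodule.span ℝ {w | ∃ c : ℝ → Matrix m n R, (∀ t, c t ∈ S) ∧ c 0 = x ∧
    ∀ i j, HasDerivAt (fun t => c t i j) (w i j) 0}

variable {n : Type*} {R : Type*} [Fintype n] [DecidableEq n] [Semiring R] [StarRing R]

/-- A set of square matrices is a subgroup (of a unitary group) if it contains `1` and is
closed under multiplication and conjugate transposition (= inversion, for unitary
matrices). -/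
def IsMatSubgroup (G : Set (Matrix n n R)) : Prop :=
  (1 : Matrix n n R) ∈ G ∧ (∀ a ∈ G, ∀ b ∈ G, a * b ∈ G) ∧ ∀ a ∈ G, star a ∈ G

/-- The orbit of `k` under the action of `G × H` by left and right translations,
`(g, h) · k = g * k * h⁻¹` (for unitary matrices `h⁻¹ = star h`). -/
def lrOrbit (G H : Set (Matrix n n R)) (k : Matrix n n R) : Set (Matrix n n R) :=
  {x | ∃ g ∈ G, ∃ h ∈ H, x = g * k * star h}

/-- The dimension of a matrix group: the dimension of its tangent space at `1`. -/
def grpDim [NormedAddCommGroup R] [NormedSpace ℝ R] (K : Set (Matrix n n R)) : ℕ :=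
  finrank ℝ (matTangentAt K 1)

/-- The cohomogeneity of the action of `G × H` on `K` by left and right translations:
`dim K` minus the maximal orbit dimension. -/
def lrCohomogeneity [NormedAddCommGroup R] [NormedSpace ℝ R]
    (G H K : Set (Matrix n n R)) : ℕ :=
  grpDim K - ⨆ k : K, finrank ℝ (matTangentAt (lrOrbit G H k) (k : Matrix n n R))

end

noncomputable section

/-- The compact symplectic group `Sp n`: quaternionic `n × n` unitary matrices. -/
def SpSet (n : ℕ) : Set (Matrix (Fin n) (Fin n) (Quaternion ℝ)) :=
  {A | star A * A = 1 ∧ A * star A = 1}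

/-- The subgroup `Sp(1)ⁿ ⊆ Sp n` of diagonal matrices with unit quaternion entries. -/
def diagSp1 (n : ℕ) : Set (Matrix (Fin n) (Fin n) (Quaternion ℝ)) :=
  {A | ∃ q : Fin n → Quaternion ℝ, (∀ i, q i ∈ unitary (Quaternion ℝ)) ∧
    A = Matrix.diagonal q}

end

noncomputable section

namespace SpSubgroup

open scoped Quaternion

variable {n : ℕ}

lemma quaternion_star_smul (r : ℝ) (q : ℍ[ℝ]) : star (r • q) = r • star q := by
  ext <;> simp

/-- The standard quaternionic Hermitian form `x* y` on column vectors. -/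
def ip : (Fin n → ℍ[ℝ]) →ₗ[ℝ] (Fin n → ℍ[ℝ]) →ₗ[ℝ] ℍ[ℝ] :=
  LinearMap.mk₂ ℝ (fun x y => ∑ i, star (x i) * y i)
    (fun x x' y => by simp [add_mul, Finset.sum_add_distrib])
    (fun r x y => by simp [Finset.smul_sum])
    (fun x y y' => by simp [mul_add, Finset.sum_add_distrib])
    (fun r x y => by simp [Finset.smul_sum])

/-- Right multiplication of a column vector by a quaternion. -/
def rs : (Fin n → ℍ[ℝ]) →ₗ[ℝ] ℍ[ℝ] →ₗ[ℝ] (Fin n → ℍ[ℝ]) :=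
  LinearMap.mk₂ ℝ (fun x c i => x i * c)
    (fun x x' c => by ext1 i; simp [add_mul])
    (fun r x c => by ext1 i; simp)
    (fun x c c' => by ext1 i; simp [mul_add])
    (fun r x c => by ext1 i; simp)

/-- The skew-Hermitian matrix `x y* - y x*`. -/
def skewPair : (Fin n → ℍ[ℝ]) →ₗ[ℝ] (Fin n → ℍ[ℝ]) →ₗ[ℝ] Matrix (Fin n) (Fin n) ℍ[ℝ] :=
  LinearMap.mk₂ ℝ (fun x y => Matrix.of fun i j => x i * star (y j) - y i * star (x j))
    (fun x x' y => by ext1 i j; simp [add_mul, mul_add]; abel)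
    (fun r x y => by ext1 i j; simp [smul_sub])
    (fun x y y' => by ext1 i j; simp [add_mul, mul_add]; abel)
    (fun r x y => by ext1 i j; simp [smul_sub])

lemma ip_apply (x y : Fin n → ℍ[ℝ]) : ip x y = ∑ i, star (x i) * y i := rfl

lemma rs_apply (x : Fin n → ℍ[ℝ]) (c : ℍ[ℝ]) (i : Fin n) : rs x c i = x i * c := rfl

lemma skewPair_apply (x y : Fin n → ℍ[ℝ]) (i j : Fin n) :
    skewPair x y i j = x i * star (y j) - y i * star (x j) := rfl

/-- The skew-Hermitian quaternionic matrices, the Lie algebra of `Sp n`. -/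
def spAlg (n : ℕ) : Submodule ℝ (Matrix (Fin n) (Fin n) ℍ[ℝ]) where
  carrier := {X | star X = -X}
  add_mem' {X Y} hX hY := by
    simp only [Set.mem_ofPred_eq] at *
    rw [star_add, hX, hY]; abel
  zero_mem' := by simp
  smul_mem' r X hX := by
    simp only [Set.mem_ofPred_eq] at *
    ext1 i j
    have := congrFun (congrFun hX i) j
    simp only [Matrix.star_apply, Matrix.neg_apply, Matrix.smul_apply] at *
    rw [quaternion_star_smul, this, smul_neg]

lemma mem_spAlg {X : Matrix (Fin n) (Fin n) ℍ[ℝ]} : X ∈ spAlg n ↔ star X = -X := Iff.rfl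

lemma skewPair_mem (x y : Fin n → ℍ[ℝ]) : skewPair x y ∈ spAlg n := by
  rw [mem_spAlg]
  ext1 i j
  simp [Matrix.star_apply, skewPair_apply]

lemma skewPair_comm (x y : Fin n → ℍ[ℝ]) : skewPair x y = -skewPair y x := by
  ext1 i j
  simp [skewPair_apply]

lemma skewPair_rs (x y : Fin n → ℍ[ℝ]) (c : ℍ[ℝ]) :
    skewPair (rs x c) y = skewPair x (rs y (star c)) := by
  ext1 i j
  simp [skewPair_apply, rs_apply, mul_assoc]

lemma skewPair_mulVec (x y z : Fin n → ℍ[ℝ]) :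
    (skewPair x y).mulVec z = rs x (ip y z) - rs y (ip x z) := by
  ext1 i
  simp only [Matrix.mulVec, dotProduct, skewPair_apply, Pi.sub_apply, rs_apply, ip_apply,
    Finset.mul_sum, sub_mul, Finset.sum_sub_distrib, mul_assoc]

lemma bracket_skewPair {Y : Matrix (Fin n) (Fin n) ℍ[ℝ]} (hY : Y ∈ spAlg n)
    (x y : Fin n → ℍ[ℝ]) :
    Y * skewPair x y - skewPair x y * Y
      = skewPair (Y.mulVec x) y + skewPair x (Y.mulVec y) := by
  rw [mem_spAlg] at hY
  have h : ∀ i j, Y i j = -star (Y j i) := fun i j => by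
    have := congrFun (congrFun hY i) j
    simp only [Matrix.star_apply, Matrix.neg_apply] at this
    rw [this, neg_neg]
  ext1 i j
  simp only [Matrix.sub_apply, Matrix.mul_apply, skewPair_apply, Matrix.add_apply, Matrix.mulVec,
    dotProduct, star_sum, star_mul, Finset.mul_sum, Finset.sum_mul, mul_sub, sub_mul,
    Finset.sum_sub_distrib, mul_assoc]
  have e : ∀ x y : Fin n → ℍ[ℝ], ∑ k, x i * (star (y k) * Y k j)
      = - ∑ k, x i * (star (y k) * star (Y j k)) := fun x y => by
    rw [← Finset.sum_neg_distrib]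
    exact Finset.sum_congr rfl fun k _ => by rw [h k j]; simp
  rw [e x y, e y x]
  abel

lemma star_ip (x y : Fin n → ℍ[ℝ]) : star (ip x y) = ip y x := by
  simp [ip_apply, star_sum]

lemma ip_rs (x y : Fin n → ℍ[ℝ]) (c : ℍ[ℝ]) : ip x (rs y c) = ip x y * c := by
  simp [ip_apply, rs_apply, Finset.sum_mul, mul_assoc]

lemma rs_ip (x y : Fin n → ℍ[ℝ]) (c : ℍ[ℝ]) : ip (rs x c) y = star c * ip x y := by
  simp [ip_apply, rs_apply, Finset.mul_sum, mul_assoc]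

lemma rs_rs (x : Fin n → ℍ[ℝ]) (c d : ℍ[ℝ]) : rs (rs x c) d = rs x (c * d) := by
  ext1 i; simp [rs_apply, mul_assoc]

lemma rs_one (x : Fin n → ℍ[ℝ]) : rs x 1 = x := by
  ext1 i; simp [rs_apply]

lemma rs_coe (x : Fin n → ℍ[ℝ]) (r : ℝ) : rs x (r : ℍ[ℝ]) = r • x := by
  ext1 i; simp [rs_apply, Quaternion.mul_coe_eq_smul]

lemma skewPair_self (x : Fin n → ℍ[ℝ]) : skewPair x x = 0 := by
  ext1 i j; simp [skewPair_apply]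

lemma ip_self (x : Fin n → ℍ[ℝ]) :
    ip x x = ((∑ i, Quaternion.normSq (x i) : ℝ) : ℍ[ℝ]) := by
  simp only [ip_apply, Quaternion.star_mul_self]
  exact (map_sum (algebraMap ℝ ℍ[ℝ]) _ _).symm

lemma ip_self_eq_zero {x : Fin n → ℍ[ℝ]} (h : (ip x x).re = 0) : x = 0 := by
  rw [ip_self, Quaternion.re_coe,
    Finset.sum_eq_zero_iff_of_nonneg fun i _ => Quaternion.normSq_nonneg] at h
  ext1 i
  exact Quaternion.normSq_eq_zero.1 (h i (Finset.mem_univ i))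

/-- A nonzero vector has a real multiple of norm one. -/
lemma exists_normalize {x : Fin n → ℍ[ℝ]} (h : x ≠ 0) :
    ∃ r : ℝ, r ≠ 0 ∧ ip (r • x) (r • x) = 1 := by
  have hx : 0 < ∑ i, Quaternion.normSq (x i) := by
    refine lt_of_le_of_ne (Finset.sum_nonneg fun i _ => Quaternion.normSq_nonneg) fun h0 => h ?_
    exact ip_self_eq_zero (by rw [ip_self, ← h0]; simp)
  refine ⟨(√(∑ i, Quaternion.normSq (x i)))⁻¹, by positivity, ?_⟩
  rw [LinearMap.map_smul₂, map_smul, ip_self, smul_smul, ← mul_inv, Real.mul_self_sqrt hx.le,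
    Quaternion.smul_coe, inv_mul_cancel₀ hx.ne']
  simp

/-- A real Lie subalgebra of `spAlg n`. -/
structure IsLieSubalg (g : Submodule ℝ (Matrix (Fin n) (Fin n) ℍ[ℝ])) : Prop where
  le : g ≤ spAlg n
  bracket : ∀ X ∈ g, ∀ Y ∈ g, X * Y - Y * X ∈ g

lemma IsLieSubalg.skewPair_bracket {g : Submodule ℝ (Matrix (Fin n) (Fin n) ℍ[ℝ])}
    (hg : IsLieSubalg g) {Y : Matrix (Fin n) (Fin n) ℍ[ℝ]} (hY : Y ∈ g) {x y : Fin n → ℍ[ℝ]}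
    (h : skewPair x y ∈ g) : skewPair (Y.mulVec x) y + skewPair x (Y.mulVec y) ∈ g := by
  rw [← bracket_skewPair (hg.le hY)]
  exact hg.bracket _ hY _ h

/-- A subspace of small codimension meets a large family of skew-Hermitian matrices. -/
lemma finrank_le_comap {F : Type*} [AddCommGroup F] [Module ℝ F] [FiniteDimensional ℝ F]
    {g : Submodule ℝ (Matrix (Fin n) (Fin n) ℍ[ℝ])} (hg : g ≤ spAlg n) {d : ℕ}
    (hd : finrank ℝ (spAlg n) ≤ finrank ℝ g + d)
    (f : F →ₗ[ℝ] Matrix (Fin n) (Fin n) ℍ[ℝ]) (hf : Function.Injective f)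
    (hfs : ∀ x, f x ∈ spAlg n) : finrank ℝ F ≤ finrank ℝ (g.comap f) + d := by
  have h1 := Submodule.finrank_sup_add_finrank_inf_eq g (LinearMap.range f)
  have h2 : finrank ℝ (g ⊔ LinearMap.range f : Submodule ℝ _) ≤ finrank ℝ (spAlg n) :=
    Submodule.finrank_mono (sup_le hg (by rintro _ ⟨x, rfl⟩; exact hfs x))
  have h3 := LinearMap.finrank_range_of_inj hf
  have h4 : finrank ℝ (g ⊓ LinearMap.range f : Submodule ℝ _) = finrank ℝ (g.comap f) := by
    rw [inf_comm, ← Submodule.map_comap_eq]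
    exact LinearEquiv.finrank_eq (Submodule.equivMapOfInjective f hf _).symm
  omega

lemma exists_mem_of_finrank_lt {F : Type*} [AddCommGroup F] [Module ℝ F] [FiniteDimensional ℝ F]
    {g : Submodule ℝ (Matrix (Fin n) (Fin n) ℍ[ℝ])} (hg : g ≤ spAlg n) {d : ℕ}
    (hd : finrank ℝ (spAlg n) ≤ finrank ℝ g + d)
    (f : F →ₗ[ℝ] Matrix (Fin n) (Fin n) ℍ[ℝ]) (hf : Function.Injective f)
    (hfs : ∀ x, f x ∈ spAlg n) (hF : d < finrank ℝ F) : ∃ x, x ≠ 0 ∧ f x ∈ g := by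
  have h := finrank_le_comap hg hd f hf hfs
  have : g.comap f ≠ ⊥ := fun h0 => by
    rw [h0, finrank_bot] at h
    omega
  obtain ⟨x, hx, hx0⟩ := Submodule.exists_mem_ne_zero_of_ne_bot this
  exact ⟨x, hx0, hx⟩

/-- The vectors orthogonal to a family of vectors. -/
def orthFam {ι : Type*} (v : ι → Fin n → ℍ[ℝ]) : Submodule ℝ (Fin n → ℍ[ℝ]) :=
  LinearMap.ker (LinearMap.pi fun i => ip (v i))

lemma mem_orthFam {ι : Type*} {v : ι → Fin n → ℍ[ℝ]} {z : Fin n → ℍ[ℝ]} :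
    z ∈ orthFam v ↔ ∀ i, ip (v i) z = 0 := by
  simp [orthFam, funext_iff]

lemma finrank_orthFam {ι : Type*} [Fintype ι] (v : ι → Fin n → ℍ[ℝ]) :
    4 * n ≤ finrank ℝ (orthFam v) + 4 * Fintype.card ι := by
  have h := LinearMap.finrank_range_add_finrank_ker (LinearMap.pi fun i => ip (v i))
  have h2 := Submodule.finrank_le (LinearMap.range (LinearMap.pi fun i => ip (v i)))
  simp only [Module.finrank_pi_fintype, Quaternion.finrank_eq_four, Finset.sum_const,
    Finset.card_univ, Fintype.card_fin, smul_eq_mul] at h h2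
  change 4 * n ≤ finrank ℝ (LinearMap.ker (LinearMap.pi fun i => ip (v i))) + _
  omega

/-- An orthonormal family `v` such that `g` contains every skew-Hermitian matrix supported on the
quaternionic span of `v`. -/
structure IsSpFrame (g : Submodule ℝ (Matrix (Fin n) (Fin n) ℍ[ℝ])) {k : ℕ}
    (v : Fin k → Fin n → ℍ[ℝ]) : Prop where
  ip_self : ∀ i, ip (v i) (v i) = 1
  ip_ne : ∀ i j, i ≠ j → ip (v i) (v j) = 0
  mem : ∀ i j c, skewPair (v i) (rs (v j) c) ∈ g

/-- The linear map `Z ↦ ∑ i, (vᵢ Zᵢ* - Zᵢ vᵢ*)`. -/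
def mixedMap {k : ℕ} (v : Fin k → Fin n → ℍ[ℝ]) :
    (Fin k → orthFam v) →ₗ[ℝ] Matrix (Fin n) (Fin n) ℍ[ℝ] :=
  ∑ i, (skewPair (v i)) ∘ₗ (orthFam v).subtype ∘ₗ LinearMap.proj i

lemma mixedMap_apply {k : ℕ} (v : Fin k → Fin n → ℍ[ℝ]) (Z : Fin k → orthFam v) :
    mixedMap v Z = ∑ i, skewPair (v i) (Z i) := by
  simp [mixedMap]

lemma IsSpFrame.mixedMap_mulVec {g : Submodule ℝ (Matrix (Fin n) (Fin n) ℍ[ℝ])} {k : ℕ}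
    {v : Fin k → Fin n → ℍ[ℝ]} (hv : IsSpFrame g v) (Z : Fin k → orthFam v) (j : Fin k) :
    (mixedMap v Z).mulVec (v j) = -(Z j : Fin n → ℍ[ℝ]) := by
  have h0 : ∀ i, ip (Z i : Fin n → ℍ[ℝ]) (v j) = 0 := fun i => by
    rw [← star_ip, mem_orthFam.1 (Z i).2 j, star_zero]
  rw [mixedMap_apply, Matrix.sum_mulVec]
  simp only [skewPair_mulVec, h0, map_zero, zero_sub]
  rw [Finset.sum_eq_single j]
  · rw [hv.ip_self, rs_one]
  · intro i _ hij
    rw [hv.ip_ne i j hij, map_zero, neg_zero]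
  · simp

/-- If a frame is not a basis, then `g` contains a nonzero `vⱼ z* - z vⱼ*` with `z` orthogonal to
the frame. -/
lemma IsSpFrame.exists_orth {g : Submodule ℝ (Matrix (Fin n) (Fin n) ℍ[ℝ])} (hg : IsLieSubalg g)
    (hn : 6 ≤ n) (hd : finrank ℝ (spAlg n) ≤ finrank ℝ g + (3 * n + 1)) {k : ℕ}
    (hk : 1 ≤ k) (hkn : k < n) {v : Fin k → Fin n → ℍ[ℝ]} (hv : IsSpFrame g v) :
    ∃ j z, z ∈ orthFam v ∧ z ≠ 0 ∧ ∀ c, skewPair (rs (v j) c) z ∈ g := by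
  have hinj : Function.Injective (mixedMap v) := by
    rw [injective_iff_map_eq_zero]
    intro Z hZ
    ext1 j
    have := hv.mixedMap_mulVec Z j
    rw [hZ, Matrix.zero_mulVec, eq_comm, neg_eq_zero] at this
    exact Subtype.ext this
  have hdim : 3 * n + 1 < finrank ℝ (Fin k → orthFam v) := by
    have h := finrank_orthFam v
    rw [Fintype.card_fin] at h
    rw [Module.finrank_pi_fintype]
    simp only [Finset.sum_const, Finset.card_univ, Fintype.card_fin, smul_eq_mul]
    have : 4 * (n - k) ≤ finrank ℝ (orthFam v) := by omega
    refine lt_of_lt_of_le ?_ (Nat.mul_le_mul_left k this)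
    obtain ⟨m, rfl⟩ : ∃ m, n = k + 1 + m := ⟨n - (k + 1), by omega⟩
    obtain ⟨l, rfl⟩ : ∃ l, k = 1 + l := ⟨k - 1, by omega⟩
    have : 1 + l + 1 + m - (1 + l) = 1 + m := by omega
    rw [this]
    nlinarith [Nat.zero_le (l * m)]
  obtain ⟨Z, hZ0, hZ⟩ := exists_mem_of_finrank_lt hg.le hd (mixedMap v) hinj
    (fun Z => by
      rw [mixedMap_apply]
      exact Submodule.sum_mem _ fun i _ => skewPair_mem _ _) hdim
  obtain ⟨j, hj⟩ := Function.ne_iff.1 hZ0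
  have hD : ∀ q : ℍ[ℝ], q.re = 0 → ∀ x,
      (skewPair (v j) (rs (v j) q)).mulVec x = rs (v j) ((-2 : ℝ) • (q * ip (v j) x)) := by
    intro q hq x
    have hs : star q = -q := by ext <;> simp [hq]
    rw [skewPair_mulVec, rs_ip, rs_rs, hs, ← map_sub]
    congr 1
    rw [neg_mul, neg_smul, two_smul, neg_add, sub_eq_add_neg]
  have hD1 : ∀ q : ℍ[ℝ], q.re = 0 → skewPair (rs (v j) q) (Z j) ∈ g := by
    intro q hq
    have hs : star q = -q := by ext <;> simp [hq]
    have h := hg.bracket _ (hv.mem j j q) _ hZ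
    have hZ0 : ∀ i l, ip (v i) (Z l : Fin n → ℍ[ℝ]) = 0 := fun i l => mem_orthFam.1 (Z l).2 i
    rw [mixedMap_apply, Finset.mul_sum, Finset.sum_mul, ← Finset.sum_sub_distrib,
      Finset.sum_eq_single j] at h
    · rw [bracket_skewPair (skewPair_mem _ _), hD q hq,
        hD q hq, hZ0, hv.ip_self, mul_one, mul_zero, smul_zero, map_zero,
        map_zero, add_zero, map_smul, LinearMap.map_smul₂] at h
      exact (Submodule.smul_mem_iff g (by norm_num)).1 h
    · intro i _ hi
      rw [bracket_skewPair (skewPair_mem _ _), skewPair_mulVec, skewPair_mulVec, rs_ip, rs_ip,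
        hZ0, hv.ip_ne j i hi.symm]
      simp
    · simp
  refine ⟨j, Z j, (Z j).2, fun h => hj (Subtype.ext h), fun c => ?_⟩
  let I : ℍ[ℝ] := ⟨0, 1, 0, 0⟩
  have hI : I * I = -1 := by
    have key : ∀ q : ℍ[ℝ], q.re = 0 → q.imI = 1 → q.imJ = 0 → q.imK = 0 → q * q = -1 := by
      intro q h0 h1 h2 h3
      ext <;> simp [Quaternion.re_mul, Quaternion.imI_mul, Quaternion.imJ_mul, Quaternion.imK_mul,
        h0, h1, h2, h3]
    exact key I rfl rfl rfl rfl
  have h1 : skewPair (v j) (Z j) ∈ g := by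
    have h := hg.skewPair_bracket (hv.mem j j I) (hD1 I rfl)
    have hZ0 : ip (v j) (Z j : Fin n → ℍ[ℝ]) = 0 := mem_orthFam.1 (Z j).2 j
    rw [hD I rfl,
      hD I rfl, ip_rs, hv.ip_self, hZ0, one_mul, hI,
      mul_zero, smul_zero, map_zero, map_zero, add_zero, smul_neg, ← neg_smul, map_smul, rs_one,
      LinearMap.map_smul₂] at h
    exact (Submodule.smul_mem_iff g (by norm_num)).1 h
  have hc : c = (c.re : ℍ[ℝ]) + c.im := (Quaternion.re_add_im c).symm
  rw [hc, map_add, LinearMap.map_add₂, rs_coe, LinearMap.map_smul₂]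
  exact g.add_mem (g.smul_mem _ h1) (hD1 _ (by simp))

lemma IsSpFrame.extend {g : Submodule ℝ (Matrix (Fin n) (Fin n) ℍ[ℝ])} (hg : IsLieSubalg g)
    (hn : 6 ≤ n) (hd : finrank ℝ (spAlg n) ≤ finrank ℝ g + (3 * n + 1)) {k : ℕ}
    (hk : 1 ≤ k) (hkn : k < n) {v : Fin k → Fin n → ℍ[ℝ]} (hv : IsSpFrame g v) :
    ∃ w : Fin (k + 1) → Fin n → ℍ[ℝ], IsSpFrame g w := by
  obtain ⟨j, z', hz', hz0', hjz'⟩ := hv.exists_orth hg hn hd hk hkn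
  obtain ⟨r, hr, hz1⟩ := exists_normalize hz0'
  set z := r • z' with hzdef
  have hz : ∀ i, ip (v i) z = 0 := mem_orthFam.1 ((orthFam v).smul_mem r hz')
  have hz2 : ∀ i, ip z (v i) = 0 := fun i => by rw [← star_ip, hz, star_zero]
  have hjz : ∀ c, skewPair (rs (v j) c) z ∈ g := fun c => by
    rw [hzdef, map_smul]
    exact g.smul_mem _ (hjz' c)
  have hjz1 : skewPair (v j) z ∈ g := by simpa [rs_one] using hjz 1
  have hiz : ∀ i c, skewPair (v i) (rs z c) ∈ g := by
    intro i c
    have hgoal : skewPair (v i) (rs z c) = skewPair (rs (v i) (star c)) z := by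
      rw [skewPair_rs, star_star]
    rw [hgoal]
    by_cases hij : i = j
    · rw [hij]; exact hjz _
    · have h := hg.skewPair_bracket (hv.mem i j c) hjz1
      rwa [skewPair_mulVec, skewPair_mulVec, rs_ip, rs_ip, hz, hz, hv.ip_self, hv.ip_ne i j hij,
        mul_one, mul_zero, map_zero, map_zero, sub_zero, sub_zero, map_zero, add_zero] at h
  have hzz : ∀ c, skewPair z (rs z c) ∈ g := by
    intro c
    have hgoal : skewPair z (rs z c) = skewPair (rs z (star c)) z := by
      rw [skewPair_rs, star_star]
    have h1 : skewPair z (rs (v j) c) ∈ g := by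
      rw [skewPair_comm, skewPair_rs]
      exact g.neg_mem (hiz _ _)
    have h := hg.skewPair_bracket h1 hjz1
    rw [skewPair_mulVec, skewPair_mulVec, rs_ip, rs_ip, hz, hz2, hv.ip_self, hz1, mul_one,
      mul_zero, map_zero, map_zero, sub_zero, zero_sub, rs_one, map_neg] at h
    rw [hgoal]
    have := g.add_mem h (hv.mem j j c)
    rwa [neg_add_cancel_right] at this
  refine ⟨Fin.cons z v, ⟨?_, ?_, ?_⟩⟩
  · intro i
    cases i using Fin.cases with
    | zero => simpa using hz1
    | succ i => simpa using hv.ip_self i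
  · intro i l hil
    cases i using Fin.cases with
    | zero =>
      cases l using Fin.cases with
      | zero => exact absurd rfl hil
      | succ l => simpa using hz2 l
    | succ i =>
      cases l using Fin.cases with
      | zero => simpa using hz i
      | succ l => simpa using hv.ip_ne i l (fun h => hil (by rw [h]))
  · intro i l c
    cases i using Fin.cases with
    | zero =>
      cases l using Fin.cases with
      | zero => simpa using hzz c
      | succ l =>
        simp only [Fin.cons_zero, Fin.cons_succ]
        rw [skewPair_comm, skewPair_rs]
        exact g.neg_mem (hiz _ _)
    | succ i =>
      cases l using Fin.cases with
      | zero => simpa using hiz i c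
      | succ l => simpa using hv.mem i l c

lemma IsSpFrame.eq_spAlg {g : Submodule ℝ (Matrix (Fin n) (Fin n) ℍ[ℝ])} (hg : IsLieSubalg g)
    {v : Fin n → Fin n → ℍ[ℝ]} (hv : IsSpFrame g v) : g = spAlg n := by
  refine le_antisymm hg.le fun Y hY => ?_
  have hU : (Matrix.of fun i j => star (v i j)) * (Matrix.of fun i j => v j i) = 1 := by
    ext1 i j
    rw [Matrix.mul_apply, Matrix.one_apply]
    change ip (v i) (v j) = _
    split_ifs with h
    · rw [h, hv.ip_self]
    · exact hv.ip_ne i j h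
  have hU' := mul_eq_one_comm.1 hU
  have hU2 : ∀ i l, ∑ j, v j i * star (v j l) = if i = l then 1 else 0 := fun i l => by
    have := congrFun (congrFun hU' i) l
    rwa [Matrix.mul_apply, Matrix.one_apply] at this
  have hexp : ∀ x : Fin n → ℍ[ℝ], x = ∑ j, rs (v j) (ip (v j) x) := fun x => by
    ext1 i
    rw [Finset.sum_apply]
    simp only [rs_apply, ip_apply, Finset.mul_sum]
    rw [Finset.sum_comm]
    simp only [← mul_assoc, ← Finset.sum_mul, hU2]
    simp
  have hkey : (2 : ℝ) • Y = ∑ j, skewPair (Y.mulVec (v j)) (v j) := by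
    have h : ∀ i j, star (Y j i) = -Y i j := fun i j => by
      have := congrFun (congrFun (mem_spAlg.1 hY) i) j
      simpa only [Matrix.star_apply, Matrix.neg_apply] using this
    have e1 : ∀ i l, ∑ j, (Y.mulVec (v j)) i * star (v j l) = Y i l := fun i l => by
      simp only [Matrix.mulVec, dotProduct, Finset.sum_mul, mul_assoc]
      rw [Finset.sum_comm]
      simp only [← Finset.mul_sum, hU2]
      simp
    ext1 i l
    rw [Matrix.sum_apply]
    simp only [skewPair_apply, Finset.sum_sub_distrib]
    rw [e1]
    have e2 : ∑ j, v j i * star ((Y.mulVec (v j)) l) = - Y i l := by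
      rw [← h, ← e1 l i, star_sum]
      simp
    rw [e2, Matrix.smul_apply, two_smul, sub_neg_eq_add]
  rw [← Submodule.smul_mem_iff g (two_ne_zero : (2 : ℝ) ≠ 0), hkey]
  refine Submodule.sum_mem _ fun j _ => ?_
  rw [hexp (Y.mulVec (v j)), map_sum, LinearMap.sum_apply]
  refine Submodule.sum_mem _ fun i _ => ?_
  rw [skewPair_rs]
  exact hv.mem _ _ _

lemma eq_spAlg_of_frame {g : Submodule ℝ (Matrix (Fin n) (Fin n) ℍ[ℝ])} (hg : IsLieSubalg g)
    (hn : 6 ≤ n) (hd : finrank ℝ (spAlg n) ≤ finrank ℝ g + (3 * n + 1))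
    {v : Fin 1 → Fin n → ℍ[ℝ]} (hv : IsSpFrame g v) : g = spAlg n := by
  have h : ∀ k, 1 ≤ k → k ≤ n → ∃ w : Fin k → Fin n → ℍ[ℝ], IsSpFrame g w := by
    intro k hk
    induction k, hk using Nat.le_induction with
    | base => exact fun _ => ⟨v, hv⟩
    | succ k hk ih =>
      intro hkn
      obtain ⟨w, hw⟩ := ih (by omega)
      exact hw.extend hg hn hd hk (by omega)
  obtain ⟨w, hw⟩ := h n (by omega) le_rfl
  exact hw.eq_spAlg hg

/-- A rotation-invariant subspace of `E × E = E ⊗ ℂ` without nonzero isotropic vectors is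
spanned by one vector and its rotation. -/
lemma exists_le_span_of_anisotropic {E : Type*} [NormedAddCommGroup E] [InnerProductSpace ℝ E]
    (G : Submodule ℝ (E × E)) (hJ : ∀ s ∈ G, (-s.2, s.1) ∈ G)
    (hG : ∀ s ∈ G, inner ℝ s.1 s.1 = inner ℝ s.2 s.2 → inner ℝ s.1 s.2 = (0 : ℝ) → s = 0) :
    ∃ t : E × E, G ≤ Submodule.span ℝ (Set.range ![t, (-t.2, t.1)]) := by
  by_cases h0 : G = ⊥
  · exact ⟨0, by simp [h0]⟩
  obtain ⟨t, ht, ht0⟩ := Submodule.exists_mem_ne_zero_of_ne_bot h0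
  refine ⟨t, fun s hs => ?_⟩
  let B : E × E → E × E → ℂ := fun s t =>
    ⟨inner ℝ s.1 t.1 - inner ℝ s.2 t.2, inner ℝ s.1 t.2 + inner ℝ s.2 t.1⟩
  have hB : B t t ≠ 0 := by
    intro h
    have h1 := congrArg Complex.re h
    have h2 := congrArg Complex.im h
    simp only [B, Complex.zero_re, Complex.zero_im, real_inner_comm t.1 t.2] at h1 h2
    exact ht0 (hG t ht (by linarith) (by linarith))
  obtain ⟨d, hd⟩ := IsAlgClosed.exists_eq_mul_self (discrim (B t t) (2 * B s t) (B s s))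
  obtain ⟨l, hl⟩ := exists_quadratic_eq_zero hB ⟨d, hd⟩
  have h1 := congrArg Complex.re hl
  have h2 := congrArg Complex.im hl
  simp only [B, Complex.zero_re, Complex.zero_im, Complex.add_re, Complex.add_im, Complex.mul_re,
    Complex.mul_im, Complex.re_ofNat, Complex.im_ofNat] at h1 h2
  have c1 := real_inner_comm s.1 s.2
  have c2 := real_inner_comm t.1 t.2
  have c3 := real_inner_comm s.1 t.1
  have c4 := real_inner_comm s.1 t.2
  have c5 := real_inner_comm s.2 t.1
  have c6 := real_inner_comm s.2 t.2
  have hz : s + (l.re • t + l.im • (-t.2, t.1)) = 0 := by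
    refine hG _ (G.add_mem hs (G.add_mem (G.smul_mem _ ht) (G.smul_mem _ (hJ t ht)))) ?_ ?_
    · simp only [Prod.fst_add, Prod.snd_add, Prod.smul_fst, Prod.smul_snd, inner_add_left,
        inner_add_right, inner_smul_left, inner_smul_right, inner_neg_left, inner_neg_right,
        c1, c2, c3, c4, c5, c6, RCLike.conj_to_real] at h1 h2 ⊢
      linear_combination h1
    · simp only [Prod.fst_add, Prod.snd_add, Prod.smul_fst, Prod.smul_snd, inner_add_left,
        inner_add_right, inner_smul_left, inner_smul_right, inner_neg_left,
        c1, c2, c5, c6, RCLike.conj_to_real] at h1 h2 ⊢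
      linear_combination h2 / 2
  rw [eq_neg_of_add_eq_zero_left hz]
  refine Submodule.neg_mem _ (Submodule.add_mem _ (Submodule.smul_mem _ _ ?_)
    (Submodule.smul_mem _ _ ?_))
  · exact Submodule.subset_span ⟨0, rfl⟩
  · exact Submodule.subset_span ⟨1, rfl⟩

/-- The imaginary quaternions. -/
def imH : Submodule ℝ ℍ[ℝ] where
  carrier := {q | q.re = 0}
  add_mem' {a b} ha hb := by
    simp only [Set.mem_ofPred_eq] at *
    simp [ha, hb]
  zero_mem' := by simp
  smul_mem' r a ha := by
    simp only [Set.mem_ofPred_eq] at *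
    simp [ha]

lemma mem_imH {q : ℍ[ℝ]} : q ∈ imH ↔ q.re = 0 := Iff.rfl

lemma star_imH {q : ℍ[ℝ]} (h : q ∈ imH) : star q = -q := by
  rw [mem_imH] at h
  ext <;> simp [h]

lemma finrank_imH : 3 ≤ finrank ℝ imH := by
  let re : ℍ[ℝ] →ₗ[ℝ] ℝ := ⟨⟨fun q => q.re, fun _ _ => rfl⟩, fun _ _ => rfl⟩
  have h := LinearMap.finrank_range_add_finrank_ker re
  have h2 := Submodule.finrank_le (LinearMap.range re)
  rw [Quaternion.finrank_eq_four] at h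
  rw [Module.finrank_self] at h2
  have h3 : finrank ℝ (LinearMap.ker re) = finrank ℝ imH := rfl
  omega

lemma mul_self_of_mem_imH {a : ℍ[ℝ]} (ha : a ∈ imH) :
    a * a = ((-Quaternion.normSq a : ℝ) : ℍ[ℝ]) := by
  have h := Quaternion.self_mul_star a
  rw [star_imH ha, mul_neg] at h
  rw [Quaternion.coe_neg, ← h, neg_neg]

lemma mul_comm_neg_of_inner_eq_zero {a b : ℍ[ℝ]} (ha : a ∈ imH) (hb : b ∈ imH)
    (h : inner ℝ a b = (0 : ℝ)) : a * b = -(b * a) := by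
  rw [Quaternion.inner_def, star_imH hb, mul_neg, Quaternion.re_neg, neg_eq_zero] at h
  have hab : a * b ∈ imH := h
  have := star_imH hab
  rw [star_mul, star_imH ha, star_imH hb, neg_mul_neg] at this
  rw [this, neg_neg]

lemma eq_top_of_quaternion_frame {a b : ℍ[ℝ]} (ha : a ∈ imH) (hb : b ∈ imH) (ha0 : a ≠ 0)
    (hb0 : b ≠ 0) (h : inner ℝ a b = (0 : ℝ)) (T : Submodule ℝ ℍ[ℝ]) (h1 : 1 ∈ T) (hTa : a ∈ T)
    (hTb : b ∈ T) (hTab : a * b ∈ T) : T = ⊤ := by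
  have hli : LinearIndependent ℝ ![1, a, b, a * b] := by
    refine linearIndependent_of_ne_zero_of_inner_eq_zero (𝕜 := ℝ) ?_ ?_
    · intro i
      fin_cases i
      · exact one_ne_zero
      · exact ha0
      · exact hb0
      · exact mul_ne_zero ha0 hb0
    · have hsymm : ∀ x y : ℍ[ℝ], inner ℝ x y = (0 : ℝ) → inner ℝ y x = (0 : ℝ) :=
        fun x y hxy => by rw [real_inner_comm]; exact hxy
      have h1a : inner ℝ 1 a = (0 : ℝ) := by
        rw [Quaternion.inner_def, star_imH ha, one_mul, Quaternion.re_neg, mem_imH.1 ha, neg_zero]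
      have h1b : inner ℝ 1 b = (0 : ℝ) := by
        rw [Quaternion.inner_def, star_imH hb, one_mul, Quaternion.re_neg, mem_imH.1 hb, neg_zero]
      have h1ab : inner ℝ 1 (a * b) = (0 : ℝ) := by
        rw [Quaternion.inner_def, star_mul, one_mul, ← star_mul, Quaternion.re_star]
        rw [Quaternion.inner_def, star_imH hb, mul_neg, Quaternion.re_neg, neg_eq_zero] at h
        exact h
      have haab : inner ℝ a (a * b) = (0 : ℝ) := by
        rw [Quaternion.inner_def, star_mul, star_imH ha, star_imH hb, neg_mul_neg, ← neg_eq_zero,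
          ← Quaternion.re_neg, ← mul_neg, ← mul_comm_neg_of_inner_eq_zero ha hb h, ← mul_assoc,
          mul_self_of_mem_imH ha, Quaternion.coe_mul_eq_smul, Quaternion.re_smul, mem_imH.1 hb,
          smul_zero]
      have hbab : inner ℝ b (a * b) = (0 : ℝ) := by
        rw [Quaternion.inner_def, star_mul, star_imH ha, star_imH hb, neg_mul_neg, ← mul_assoc,
          mul_self_of_mem_imH hb, Quaternion.coe_mul_eq_smul, Quaternion.re_smul, mem_imH.1 ha,
          smul_zero]
      intro i j hij
      fin_cases i <;> fin_cases j <;>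
        first
        | exact absurd rfl hij
        | exact h1a
        | exact h1b
        | exact h1ab
        | exact haab
        | exact hbab
        | exact h
        | exact hsymm _ _ h1a
        | exact hsymm _ _ h1b
        | exact hsymm _ _ h1ab
        | exact hsymm _ _ haab
        | exact hsymm _ _ hbab
        | exact hsymm _ _ h
  have hs := hli.span_eq_top_of_card_eq_finrank' (by rw [Quaternion.finrank_eq_four]; rfl)
  rw [eq_top_iff, ← hs, Submodule.span_le]
  rintro _ ⟨i, rfl⟩
  fin_cases i
  · exact h1
  · exact hTa
  · exact hTb
  · exact hTab

/-- The map `Y ↦ X Y - Y X`. -/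
def adMap (X : Matrix (Fin n) (Fin n) ℍ[ℝ]) :
    Matrix (Fin n) (Fin n) ℍ[ℝ] →ₗ[ℝ] Matrix (Fin n) (Fin n) ℍ[ℝ] :=
  LinearMap.mulLeft ℝ X - LinearMap.mulRight ℝ X

lemma adMap_apply (X Y : Matrix (Fin n) (Fin n) ℍ[ℝ]) : adMap X Y = X * Y - Y * X := rfl

lemma adMap_skewPair {X : Matrix (Fin n) (Fin n) ℍ[ℝ]} (hX : X ∈ spAlg n)
    (x y : Fin n → ℍ[ℝ]) :
    adMap X (skewPair x y) = skewPair (X.mulVec x) y + skewPair x (X.mulVec y) :=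
  bracket_skewPair hX x y

lemma skewPair_rs_self (v : Fin n → ℍ[ℝ]) (q : ℍ[ℝ]) :
    skewPair v (rs v q) = skewPair v (rs v q.im) := by
  conv_lhs => rw [← Quaternion.re_add_im q, map_add, rs_coe, map_add, map_smul, skewPair_self,
    smul_zero, zero_add]

lemma skewPair_rs_re (v u : Fin n → ℍ[ℝ]) (q : ℍ[ℝ]) :
    skewPair v (rs u q) = q.re • skewPair v u + skewPair v (rs u q.im) := by
  conv_lhs => rw [← Quaternion.re_add_im q, map_add, rs_coe, map_add, map_smul]

lemma skewPair_rs_swap (v u : Fin n → ℍ[ℝ]) {q : ℍ[ℝ]} (hq : q ∈ imH) :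
    skewPair u (rs v q) = skewPair v (rs u q) := by
  rw [skewPair_comm, skewPair_rs, star_imH hq, map_neg, map_neg, neg_neg]

/-- The map `(z₁, z₂) ↦ v z₁* - z₁ v* + u z₂* - z₂ u*`. -/
def pairMap (v u : Fin n → ℍ[ℝ]) :
    (Fin n → ℍ[ℝ]) × (Fin n → ℍ[ℝ]) →ₗ[ℝ] Matrix (Fin n) (Fin n) ℍ[ℝ] :=
  (skewPair v).coprod (skewPair u)

lemma pairMap_apply (v u : Fin n → ℍ[ℝ]) (z : (Fin n → ℍ[ℝ]) × (Fin n → ℍ[ℝ])) :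
    pairMap v u z = skewPair v z.1 + skewPair u z.2 := rfl

/-- For imaginary `a`, `b`, twice the matrix `v a v* + v b u* + u b v* - u a u*`. -/
def symMap (v u : Fin n → ℍ[ℝ]) : ℍ[ℝ] × ℍ[ℝ] →ₗ[ℝ] Matrix (Fin n) (Fin n) ℍ[ℝ] :=
  (skewPair u ∘ₗ rs u - skewPair v ∘ₗ rs v).coprod ((-2 : ℝ) • (skewPair v ∘ₗ rs u))

lemma symMap_apply (v u : Fin n → ℍ[ℝ]) (s : ℍ[ℝ] × ℍ[ℝ]) :
    symMap v u s = skewPair u (rs u s.1) - skewPair v (rs v s.1)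
      + (-2 : ℝ) • skewPair v (rs u s.2) := rfl

/-- Two orthonormal vectors. -/
structure IsOrthoPair (v u : Fin n → ℍ[ℝ]) : Prop where
  vv : ip v v = 1
  uu : ip u u = 1
  vu : ip v u = 0
  uv : ip u v = 0

lemma IsOrthoPair.mulVec_left {v u : Fin n → ℍ[ℝ]} (h : IsOrthoPair v u) :
    (skewPair v u).mulVec v = -u := by
  rw [skewPair_mulVec, h.uv, h.vv, map_zero, rs_one, zero_sub]

lemma IsOrthoPair.mulVec_right {v u : Fin n → ℍ[ℝ]} (h : IsOrthoPair v u) :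
    (skewPair v u).mulVec u = v := by
  rw [skewPair_mulVec, h.uu, h.vu, map_zero, rs_one, sub_zero]

lemma mulVec_rs (X : Matrix (Fin n) (Fin n) ℍ[ℝ]) (x : Fin n → ℍ[ℝ]) (c : ℍ[ℝ]) :
    X.mulVec (rs x c) = rs (X.mulVec x) c := by
  ext1 i
  simp [Matrix.mulVec, dotProduct, rs_apply, Finset.sum_mul, mul_assoc]

lemma IsOrthoPair.adMap_symMap {v u : Fin n → ℍ[ℝ]} (h : IsOrthoPair v u) {a b : ℍ[ℝ]}
    (ha : a ∈ imH) :
    adMap (skewPair v u) (symMap v u (a, b)) = (2 : ℝ) • symMap v u (b, -a) := by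
  simp only [symMap_apply, map_add, map_sub, map_smul, adMap_skewPair (skewPair_mem v u),
    mulVec_rs, h.mulVec_left, h.mulVec_right, map_neg, LinearMap.neg_apply,
    skewPair_rs_swap v u ha]
  module

lemma adMap_pairMap {v u : Fin n → ℍ[ℝ]} (h : IsOrthoPair v u) {z₁ z₂ : Fin n → ℍ[ℝ]}
    (h₁ : z₁ ∈ orthFam ![v, u]) (h₂ : z₂ ∈ orthFam ![v, u]) :
    adMap (skewPair v u) (pairMap v u (z₁, z₂)) = pairMap v u (z₂, -z₁) := by
  have e : ∀ z ∈ orthFam ![v, u], (skewPair v u).mulVec z = 0 := fun z hz => by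
    have hv : ip v z = 0 := mem_orthFam.1 hz 0
    have hu : ip u z = 0 := mem_orthFam.1 hz 1
    rw [skewPair_mulVec, hv, hu, map_zero, map_zero, sub_zero]
  simp only [pairMap_apply, map_add, adMap_skewPair (skewPair_mem v u), h.mulVec_left,
    h.mulVec_right, e _ h₁, e _ h₂, map_neg, LinearMap.neg_apply, map_zero]
  abel

lemma IsOrthoPair.injective {v u : Fin n → ℍ[ℝ]} (h : IsOrthoPair v u) {z₁ z₂ : Fin n → ℍ[ℝ]}
    (h₁ : z₁ ∈ orthFam ![v, u]) (h₂ : z₂ ∈ orthFam ![v, u]) {a b : ℍ[ℝ]}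
    (ha : a ∈ imH) (hb : b ∈ imH) (h0 : pairMap v u (z₁, z₂) + symMap v u (a, b) = 0) :
    z₁ = 0 ∧ z₂ = 0 ∧ a = 0 ∧ b = 0 := by
  have hv₁ : ip v z₁ = 0 := mem_orthFam.1 h₁ 0
  have hu₁ : ip u z₁ = 0 := mem_orthFam.1 h₁ 1
  have hv₂ : ip v z₂ = 0 := mem_orthFam.1 h₂ 0
  have hu₂ : ip u z₂ = 0 := mem_orthFam.1 h₂ 1
  have hv₁' : ip z₁ v = 0 := by rw [← star_ip, hv₁, star_zero]
  have hu₁' : ip z₁ u = 0 := by rw [← star_ip, hu₁, star_zero]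
  have hv₂' : ip z₂ v = 0 := by rw [← star_ip, hv₂, star_zero]
  have hu₂' : ip z₂ u = 0 := by rw [← star_ip, hu₂, star_zero]
  have ev := congrArg (fun M => Matrix.mulVec M v) h0
  have eu := congrArg (fun M => Matrix.mulVec M u) h0
  simp only [pairMap_apply, symMap_apply, Matrix.add_mulVec, Matrix.sub_mulVec, Matrix.smul_mulVec,
    skewPair_mulVec, Matrix.zero_mulVec, rs_ip, h.vv, h.uu, h.uv, h.vu, hv₁', hu₁', hv₂', hu₂',
    mul_zero, map_zero, mul_one, rs_one, star_imH ha, star_imH hb, map_neg] at ev eu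
  have eva := congrArg (ip v) ev
  have evb := congrArg (ip u) ev
  simp only [map_add, map_sub, map_smul, map_neg, map_zero, ip_rs, h.vv, h.uu, h.uv, h.vu, hv₁,
    hu₁, zero_mul, one_mul] at eva evb
  have a0 : a = 0 := by
    have : (2 : ℝ) • a = 0 := by rw [← eva]; module
    simpa using this
  have b0 : b = 0 := by
    have : (2 : ℝ) • b = 0 := by rw [← evb]; module
    simpa using this
  subst a0 b0
  refine ⟨?_, ?_, rfl, rfl⟩
  · simpa using ev
  · simpa using eu

lemma skewPair_add_rs {v u : Fin n → ℍ[ℝ]} {a b c : ℍ[ℝ]} (hb : b ∈ imH) (hc : c ∈ imH)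
    (hca : c * a = b) (hac : a * c = -b) (hbc : b * c = a) :
    skewPair (v + rs u c) (rs (v + rs u c) a) = -symMap v u (a, b) := by
  simp only [map_add, LinearMap.add_apply, rs_rs, symMap_apply, skewPair_rs, hca, star_imH hc,
    hac, hbc, neg_neg, skewPair_rs_swap v u hb, map_neg]
  module

/-- A nonzero isotropic vector gives a quaternionic line all of whose skew-Hermitian matrices
lie in `g`. -/
lemma exists_isSpFrame_of_isotropic {g : Submodule ℝ (Matrix (Fin n) (Fin n) ℍ[ℝ])}
    (hg : IsLieSubalg g) {v u : Fin n → ℍ[ℝ]} (h : IsOrthoPair v u) (hvu : skewPair v u ∈ g)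
    {a b : ℍ[ℝ]} (ha : a ∈ imH) (hb : b ∈ imH) (ha0 : a ≠ 0)
    (hab : inner ℝ a a = (inner ℝ b b : ℝ)) (hab0 : inner ℝ a b = (0 : ℝ))
    (hs : symMap v u (a, b) ∈ g) : ∃ w : Fin 1 → Fin n → ℍ[ℝ], IsSpFrame g w := by
  have hs' : symMap v u (b, -a) ∈ g := by
    have h1 := hg.bracket _ hvu _ hs
    rw [← adMap_apply, h.adMap_symMap ha] at h1
    have := g.smul_mem (2⁻¹ : ℝ) h1
    rwa [smul_smul, inv_mul_cancel₀ two_ne_zero, one_smul] at this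
  rw [Quaternion.inner_self, Quaternion.inner_self] at hab
  have hN : Quaternion.normSq a ≠ 0 := Quaternion.normSq_ne_zero.2 ha0
  have hb0 : b ≠ 0 := by rwa [← Quaternion.normSq_ne_zero, ← hab]
  have haa := mul_self_of_mem_imH ha
  have hbb := mul_self_of_mem_imH hb
  rw [← hab] at hbb
  have hcomm := mul_comm_neg_of_inner_eq_zero ha hb hab0
  have hba : b * a ∈ imH := by
    rw [Quaternion.inner_def, star_imH hb, mul_neg, Quaternion.re_neg, neg_eq_zero] at hab0
    rw [← neg_neg (b * a), ← hcomm]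
    exact imH.neg_mem hab0
  set N := Quaternion.normSq a
  obtain ⟨c, hc⟩ : ∃ c, c = (-N⁻¹) • (b * a) := ⟨_, rfl⟩
  have hcim : c ∈ imH := hc ▸ imH.smul_mem _ hba
  have hca : c * a = b := by
    rw [hc, smul_mul_assoc, mul_assoc, haa, Quaternion.mul_coe_eq_smul, smul_smul, neg_mul_neg,
      inv_mul_cancel₀ hN, one_smul]
  have hac : a * c = -b := by
    rw [hc, mul_smul_comm, ← mul_assoc, hcomm, neg_mul, mul_assoc, haa,
      Quaternion.mul_coe_eq_smul, ← smul_neg, smul_smul, smul_neg, neg_mul_neg,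
      inv_mul_cancel₀ hN, one_smul]
  have hbc : b * c = a := by
    rw [hc, mul_smul_comm, ← mul_assoc, hbb, Quaternion.coe_mul_eq_smul, smul_smul, neg_mul_neg,
      inv_mul_cancel₀ hN, one_smul]
  have hcb : c * b = -a := by
    have := congrArg star hbc
    rwa [star_mul, star_imH hcim, star_imH hb, star_imH ha, neg_mul_neg] at this
  have hcc : c * c = -1 := by
    have h1 : (c * c) * a = (-1) * a := by rw [mul_assoc, hca, hcb, neg_one_mul]
    exact mul_right_cancel₀ ha0 h1
  obtain ⟨w, hw⟩ : ∃ w, w = v + rs u c := ⟨_, rfl⟩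
  have hww : ip w w = 2 := by
    simp only [hw, map_add, LinearMap.add_apply, ip_rs, rs_ip, h.vv, h.uu, h.uv, h.vu,
      star_imH hcim, mul_zero, zero_mul, mul_one, neg_mul, hcc]
    norm_num
  have hwa : skewPair w (rs w a) ∈ g := by
    rw [hw, skewPair_add_rs hb hcim hca hac hbc]
    exact g.neg_mem hs
  have hwb : skewPair w (rs w b) ∈ g := by
    rw [hw, skewPair_add_rs (imH.neg_mem ha) hcim hcb (by rw [hbc, neg_neg])
      (by rw [neg_mul, hac, neg_neg])]
    exact g.neg_mem hs'
  have hwab : skewPair w (rs w (a * b)) ∈ g := by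
    have h1 := hg.skewPair_bracket hwa hwb
    have e : (skewPair w (rs w a)).mulVec w = (-4 : ℝ) • rs w a := by
      rw [skewPair_mulVec, rs_ip, hww, rs_rs, star_imH ha, neg_mul, map_neg,
        show a * 2 = (2 : ℝ) • a by rw [mul_two, two_smul], map_smul]
      module
    rw [mulVec_rs, e, LinearMap.map_smul₂, LinearMap.map_smul₂, map_smul, rs_rs, skewPair_rs,
      rs_rs, star_imH ha, mul_neg, ← hcomm] at h1
    have := g.smul_mem (-(1 / 8) : ℝ) h1
    convert this using 1
    module
  have hT : (g.comap (skewPair w)).comap (rs w) = ⊤ :=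
    eq_top_of_quaternion_frame ha hb ha0 hb0 hab0 _
      (by simp [rs_one, skewPair_self]) hwa hwb hwab
  have hw0 : w ≠ 0 := by
    rintro rfl
    have h2 := congrArg (fun q : ℍ[ℝ] => q.re) hww
    have h3 : (2 : ℍ[ℝ]).re = 2 := rfl
    simp [h3] at h2
  obtain ⟨r, -, hr⟩ := exists_normalize hw0
  refine ⟨fun _ => r • w, fun _ => hr, fun i j hij => absurd (Subsingleton.elim i j) hij,
    fun _ _ q => ?_⟩
  have hq : q ∈ (g.comap (skewPair w)).comap (rs w) := hT ▸ Submodule.mem_top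
  rw [map_smul, map_smul, LinearMap.smul_apply, LinearMap.smul_apply, map_smul]
  exact g.smul_mem _ (g.smul_mem _ hq)

lemma ip_of_mem_orthFam_pair {v u z : Fin n → ℍ[ℝ]} (hz : z ∈ orthFam ![v, u]) :
    ip v z = 0 ∧ ip u z = 0 ∧ ip z v = 0 ∧ ip z u = 0 := by
  have hv : ip v z = 0 := mem_orthFam.1 hz 0
  have hu : ip u z = 0 := mem_orthFam.1 hz 1
  exact ⟨hv, hu, by rw [← star_ip, hv, star_zero], by rw [← star_ip, hu, star_zero]⟩

lemma mulVec_of_mem_orthFam_pair {v u z : Fin n → ℍ[ℝ]} (hz : z ∈ orthFam ![v, u]) :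
    (skewPair v u).mulVec z = 0 := by
  rw [skewPair_mulVec, (ip_of_mem_orthFam_pair hz).1, (ip_of_mem_orthFam_pair hz).2.1, map_zero,
    map_zero, sub_zero]

lemma pairMap_mem (v u : Fin n → ℍ[ℝ]) (z : (Fin n → ℍ[ℝ]) × (Fin n → ℍ[ℝ])) :
    pairMap v u z ∈ spAlg n :=
  add_mem (skewPair_mem _ _) (skewPair_mem _ _)

lemma symMap_mem (v u : Fin n → ℍ[ℝ]) (s : ℍ[ℝ] × ℍ[ℝ]) : symMap v u s ∈ spAlg n :=
  add_mem (sub_mem (skewPair_mem _ _) (skewPair_mem _ _))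
    (Submodule.smul_mem _ _ (skewPair_mem _ _))

lemma IsOrthoPair.adMap_adMap_pairMap {v u : Fin n → ℍ[ℝ]} (h : IsOrthoPair v u)
    {z₁ z₂ y₁ y₂ : Fin n → ℍ[ℝ]} (hz₁ : z₁ ∈ orthFam ![v, u]) (hz₂ : z₂ ∈ orthFam ![v, u])
    (hy₁ : y₁ ∈ orthFam ![v, u]) (hy₂ : y₂ ∈ orthFam ![v, u]) :
    adMap (skewPair v u) (adMap (pairMap v u (z₁, z₂)) (pairMap v u (y₁, y₂)))
      = symMap v u (-(ip z₂ y₁ + ip z₁ y₂).im, (ip z₁ y₁ - ip z₂ y₂).im) := by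
  obtain ⟨-, -, s₁, s₂⟩ := ip_of_mem_orthFam_pair hz₁
  obtain ⟨-, -, s₃, s₄⟩ := ip_of_mem_orthFam_pair hz₂
  obtain ⟨t₁, t₂, -, -⟩ := ip_of_mem_orthFam_pair hy₁
  obtain ⟨t₃, t₄, -, -⟩ := ip_of_mem_orthFam_pair hy₂
  have hu : ∀ q : ℍ[ℝ], skewPair u (rs v q) = -(q.re • skewPair v u) + skewPair v (rs u q.im) :=
    fun q => by
      rw [skewPair_rs_re, skewPair_comm u v, skewPair_rs_swap v u (by simp [mem_imH]), smul_neg]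
  rw [pairMap_apply v u (y₁, y₂), map_add, adMap_skewPair (pairMap_mem _ _ _),
    adMap_skewPair (pairMap_mem _ _ _)]
  simp only [pairMap_apply, Matrix.add_mulVec, skewPair_mulVec, s₁, s₂, s₃, s₄, t₁, t₂, t₃, t₄,
    h.vv, h.uu, h.uv, h.vu, map_zero, rs_one, map_add, zero_sub, sub_zero, zero_add, add_zero,
    adMap_skewPair (skewPair_mem v u), mulVec_rs, h.mulVec_left, h.mulVec_right,
    mulVec_of_mem_orthFam_pair hz₁, mulVec_of_mem_orthFam_pair hz₂,
    mulVec_of_mem_orthFam_pair hy₁, mulVec_of_mem_orthFam_pair hy₂, neg_zero,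
    LinearMap.zero_apply, map_neg, LinearMap.neg_apply, symMap_apply, Quaternion.im_add,
    Quaternion.im_sub, map_sub]
  generalize ip z₁ y₁ = α, ip z₂ y₁ = β, ip z₁ y₂ = γ, ip z₂ y₂ = δ
  rw [skewPair_rs_self v β, skewPair_rs_self v γ, skewPair_rs_self u β, skewPair_rs_self u γ,
    hu α, hu δ, skewPair_rs_re v u α, skewPair_rs_re v u δ]
  module

lemma finrank_le_of_le_prod {E F : Type*} [AddCommGroup E] [Module ℝ E] [FiniteDimensional ℝ E]
    [AddCommGroup F] [Module ℝ F] [FiniteDimensional ℝ F] {S : Submodule ℝ (E × F)}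
    {p : Submodule ℝ E} {q : Submodule ℝ F} (h : S ≤ p.prod q) :
    finrank ℝ S ≤ finrank ℝ p + finrank ℝ q := by
  rw [← Module.finrank_prod]
  refine LinearMap.finrank_le_finrank_of_injective
    (f := ((LinearMap.fst ℝ E F ∘ₗ S.subtype).codRestrict p fun x => (h x.2).1).prod
      ((LinearMap.snd ℝ E F ∘ₗ S.subtype).codRestrict q fun x => (h x.2).2)) ?_
  rintro ⟨⟨a, b⟩, _⟩ ⟨⟨c, d⟩, _⟩ hx
  exact Subtype.ext (Prod.ext (congrArg (fun y => (y.1 : E)) hx)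
    (congrArg (fun y => (y.2 : F)) hx))

lemma two_mul_finrank_le {E : Type*} [AddCommGroup E] [Module ℝ E] [FiniteDimensional ℝ E]
    {τ : E →ₗ[ℝ] E} (hτ : Function.Injective τ) {S : Submodule ℝ E}
    (h : ∀ z ∈ S, τ z ∈ S → z = 0) : 2 * finrank ℝ S ≤ finrank ℝ E := by
  have h1 := Submodule.finrank_sup_add_finrank_inf_eq S (S.map τ)
  have h2 : S ⊓ S.map τ = ⊥ := by
    rw [eq_bot_iff]
    rintro _ ⟨hy, z, hz, rfl⟩
    rw [h z hz hy, map_zero]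
    exact Submodule.zero_mem _
  have h3 := (Submodule.equivMapOfInjective τ hτ S).finrank_eq
  have h4 := Submodule.finrank_le (S ⊔ S.map τ)
  rw [h2, finrank_bot] at h1
  omega

/-- A vector orthogonal to two given imaginary quaternions. -/
lemma exists_orth_imH (x y : imH) :
    ∃ p : imH, p ≠ 0 ∧ inner ℝ p x = (0 : ℝ) ∧ inner ℝ p y = (0 : ℝ) := by
  have := LinearMap.ker_ne_bot_of_finrank_lt (f := (innerₗ imH x).prod (innerₗ imH y)) (by
    have := finrank_imH
    rw [Module.finrank_prod, Module.finrank_self]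
    omega)
  obtain ⟨p, hp, hp0⟩ := Submodule.exists_mem_ne_zero_of_ne_bot this
  have h : (inner ℝ x p, inner ℝ y p) = ((0, 0) : ℝ × ℝ) := hp
  rw [Prod.mk.injEq, real_inner_comm, real_inner_comm p y] at h
  exact ⟨p, hp0, h⟩

lemma exists_isotropic {g : Submodule ℝ (Matrix (Fin n) (Fin n) ℍ[ℝ])}
    (hg : IsLieSubalg g) (hn : 6 ≤ n) (hd : finrank ℝ (spAlg n) ≤ finrank ℝ g + (3 * n + 1))
    {v u : Fin n → ℍ[ℝ]} (h : IsOrthoPair v u) (hvu : skewPair v u ∈ g) :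
    ∃ a ∈ imH, ∃ b ∈ imH, a ≠ 0 ∧ inner ℝ a a = (inner ℝ b b : ℝ) ∧ inner ℝ a b = (0 : ℝ) ∧
      symMap v u (a, b) ∈ g := by
  by_contra! hcon
  let N := orthFam ![v, u]
  let f₁ : N × N →ₗ[ℝ] Matrix (Fin n) (Fin n) ℍ[ℝ] :=
    pairMap v u ∘ₗ N.subtype.prodMap N.subtype
  let f₂ : imH × imH →ₗ[ℝ] Matrix (Fin n) (Fin n) ℍ[ℝ] :=
    symMap v u ∘ₗ imH.subtype.prodMap imH.subtype
  have ad_mem : ∀ Y ∈ g, adMap (skewPair v u) Y ∈ g := fun Y hY => hg.bracket _ hvu _ hY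
  have had₁ : ∀ z : N × N, adMap (skewPair v u) (f₁ z) = f₁ (z.2, -z.1) := fun z =>
    adMap_pairMap h z.1.2 z.2.2
  have had₂ : ∀ s : imH × imH, adMap (skewPair v u) (f₂ s) = (2 : ℝ) • f₂ (s.2, -s.1) := fun s =>
    h.adMap_symMap s.1.2
  have hinj : Function.Injective (f₁.coprod f₂) := by
    rw [injective_iff_map_eq_zero]
    rintro ⟨⟨z₁, z₂⟩, a, b⟩ h0
    obtain ⟨e₁, e₂, e₃, e₄⟩ := h.injective z₁.2 z₂.2 a.2 b.2 h0
    simp only [Submodule.coe_eq_zero] at e₁ e₂ e₃ e₄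
    simp [e₁, e₂, e₃, e₄]
  have hle : g.comap (f₁.coprod f₂) ≤ (g.comap f₁).prod (g.comap f₂) := by
    rintro ⟨z, s⟩ hzs
    have h0 : f₁ z + f₂ s ∈ g := hzs
    have h2 := ad_mem _ (ad_mem _ h0)
    have e₁ : f₁ (-z.1, -z.2) = -f₁ z := map_neg f₁ z
    have e₂ : f₂ (-s.1, -s.2) = -f₂ s := map_neg f₂ s
    simp only [map_add, had₁, had₂, map_smul, e₁, e₂] at h2
    have h3 : f₂ s ∈ g := by
      convert g.smul_mem (-(1 / 3) : ℝ) (g.add_mem h0 h2) using 1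
      module
    refine ⟨?_, h3⟩
    have := g.sub_mem h0 h3
    rwa [add_sub_cancel_right] at this
  have hrot : ∀ s ∈ g.comap f₂, (-s.2, s.1) ∈ g.comap f₂ := by
    intro s hs
    have h1 := ad_mem _ hs
    rw [had₂] at h1
    have := g.smul_mem (-(1 / 2) : ℝ) h1
    rw [smul_smul] at this
    have e : f₂ (-s.2, s.1) = -f₂ (s.2, -s.1) := by
      rw [← map_neg]; simp
    rw [Submodule.mem_comap, e]
    convert this using 1
    module
  obtain ⟨t, ht⟩ := exists_le_span_of_anisotropic (g.comap f₂) hrot (by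
    intro s hs h1 h2
    by_contra hs0
    have ha0 : (s.1 : ℍ[ℝ]) ≠ 0 := by
      intro h0
      have h3 : s.1 = 0 := Subtype.ext h0
      rw [h3, inner_zero_left, eq_comm, inner_self_eq_zero] at h1
      exact hs0 (Prod.ext h3 h1)
    exact hcon s.1 s.1.2 s.2 s.2.2 ha0 h1 h2 hs)
  have hG2 : finrank ℝ (g.comap f₂) ≤ 2 :=
    (Submodule.finrank_mono ht).trans (finrank_range_le_card _)
  obtain ⟨p, hp0, hp₁, hp₂⟩ := exists_orth_imH t.1 t.2
  have hp : ∀ s ∈ g.comap f₂, inner ℝ p s.2 = (0 : ℝ) := by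
    have h1 : Submodule.span ℝ (Set.range ![t, (-t.2, t.1)])
        ≤ LinearMap.ker (innerₗ imH p ∘ₗ LinearMap.snd ℝ imH imH) := by
      rw [Submodule.span_le]
      rintro _ ⟨i, rfl⟩
      fin_cases i
      · exact hp₂
      · exact hp₁
    exact fun s hs => h1 (ht hs)
  have hp0' : (p : ℍ[ℝ]) ≠ 0 := by simpa using hp0
  let ρ : N →ₗ[ℝ] N := (rs.flip (p : ℍ[ℝ])).restrict fun z hz =>
    mem_orthFam.2 fun i => by
      rw [LinearMap.flip_apply, ip_rs, mem_orthFam.1 hz i, zero_mul]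
  have hρ : ∀ z : N, ((ρ z : N) : Fin n → ℍ[ℝ]) = rs (z : Fin n → ℍ[ℝ]) (p : ℍ[ℝ]) := fun _ => rfl
  have hρinj : Function.Injective ρ := by
    rw [injective_iff_map_eq_zero]
    intro z hz
    have h1 := congrArg (fun x : N => rs (x : Fin n → ℍ[ℝ]) (p : ℍ[ℝ])⁻¹) hz
    simpa [hρ, rs_rs, hp0', rs_one] using h1
  let τ : N × N →ₗ[ℝ] N × N := ρ.prodMap (-ρ)
  have hτ : Function.Injective τ :=
    Function.Injective.prodMap hρinj (fun x y hxy => hρinj (neg_injective hxy))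
  have hG1 : 2 * finrank ℝ (g.comap f₁) ≤ finrank ℝ (N × N) := by
    refine two_mul_finrank_le hτ fun z hz hτz => ?_
    have h1 := ad_mem _ (hg.bracket _ hz _ hτz)
    rw [← adMap_apply] at h1
    have h2 := h.adMap_adMap_pairMap z.1.2 z.2.2 (τ z).1.2 (τ z).2.2
    rw [show pairMap v u ((z.1 : Fin n → ℍ[ℝ]), (z.2 : Fin n → ℍ[ℝ])) = f₁ z from rfl,
      show pairMap v u (((τ z).1 : Fin n → ℍ[ℝ]), ((τ z).2 : Fin n → ℍ[ℝ]))
        = f₁ (τ z) from rfl] at h2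
    rw [h2] at h1
    have im_mem : ∀ q : ℍ[ℝ], q.im ∈ imH := fun q => by simp [mem_imH]
    have h3 := hp (⟨_, imH.neg_mem (im_mem _)⟩, ⟨_, im_mem _⟩) h1
    have e₁ : (((τ z).1 : N) : Fin n → ℍ[ℝ]) = rs (z.1 : Fin n → ℍ[ℝ]) (p : ℍ[ℝ]) := rfl
    have e₂ : (((τ z).2 : N) : Fin n → ℍ[ℝ]) = -rs (z.2 : Fin n → ℍ[ℝ]) (p : ℍ[ℝ]) := rfl
    have hpim : (p : ℍ[ℝ]).im = p := by
      have := Quaternion.re_add_im (p : ℍ[ℝ])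
      rwa [mem_imH.1 p.2, Quaternion.coe_zero, zero_add] at this
    rw [Submodule.coe_inner] at h3
    simp only [e₁, e₂, map_neg, ip_rs, sub_neg_eq_add, ip_self,
      Quaternion.coe_mul_eq_smul, ← add_smul, Quaternion.im_smul, hpim, inner_smul_right] at h3
    have hpp : inner ℝ (p : ℍ[ℝ]) (p : ℍ[ℝ]) ≠ (0 : ℝ) := by simpa using hp0'
    have h4 := (mul_eq_zero.1 h3).resolve_right hpp
    have nn : ∀ x : Fin n → ℍ[ℝ], 0 ≤ ∑ i, Quaternion.normSq (x i) := fun x =>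
      Finset.sum_nonneg fun i _ => Quaternion.normSq_nonneg
    have z0 : ∀ x : N, ∑ i, Quaternion.normSq ((x : Fin n → ℍ[ℝ]) i) = 0 → x = 0 := fun x hx =>
      Subtype.ext (ip_self_eq_zero (by rw [ip_self, hx]; simp))
    have n₁ := nn z.1
    have n₂ := nn z.2
    exact Prod.ext (z0 _ (by linarith)) (z0 _ (by linarith))
  have hN := finrank_orthFam ![v, u]
  have h1 := finrank_le_comap hg.le hd (f₁.coprod f₂) hinj
    (fun x => add_mem (pairMap_mem _ _ _) (symMap_mem _ _ _))
  have h2 := finrank_le_of_le_prod hle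
  have h3 := finrank_imH
  simp only [Module.finrank_prod, Fintype.card_fin] at h1 hG1 hN
  change 4 * n ≤ finrank ℝ N + _ at hN
  omega

/-- A Lie subalgebra of `spAlg n` of codimension at most `3 * n + 1` is everything. -/
theorem eq_spAlg_of_finrank_le {g : Submodule ℝ (Matrix (Fin n) (Fin n) ℍ[ℝ])}
    (hg : IsLieSubalg g) (hn : 6 ≤ n) (hd : finrank ℝ (spAlg n) ≤ finrank ℝ g + (3 * n + 1)) :
    g = spAlg n := by
  obtain ⟨v, hv⟩ : ∃ v : Fin n → ℍ[ℝ], ip v v = 1 := by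
    have : (Pi.single ⟨0, by omega⟩ 1 : Fin n → ℍ[ℝ]) ≠ 0 := by simp
    obtain ⟨r, -, hr⟩ := exists_normalize this
    exact ⟨_, hr⟩
  obtain ⟨z, hz0, hz⟩ := exists_mem_of_finrank_lt hg.le hd
    (skewPair v ∘ₗ (orthFam ![v]).subtype) (by
      rw [injective_iff_map_eq_zero]
      intro z hz
      have h0 : ip v (z : Fin n → ℍ[ℝ]) = 0 := mem_orthFam.1 z.2 0
      have h0' : ip (z : Fin n → ℍ[ℝ]) v = 0 := by rw [← star_ip, h0, star_zero]
      have h1 := congrArg (fun M => Matrix.mulVec M v) hz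
      simp only [LinearMap.comp_apply, Submodule.subtype_apply, skewPair_mulVec, h0', hv, map_zero,
        rs_one, zero_sub, Matrix.zero_mulVec, neg_eq_zero] at h1
      exact Subtype.ext h1)
    (fun x => skewPair_mem _ _) (by
      have := finrank_orthFam ![v]
      rw [Fintype.card_fin] at this
      omega)
  have h0 : ip v (z : Fin n → ℍ[ℝ]) = 0 := mem_orthFam.1 z.2 0
  have h0' : ip (z : Fin n → ℍ[ℝ]) v = 0 := by rw [← star_ip, h0, star_zero]
  obtain ⟨r, -, hr⟩ := exists_normalize (x := (z : Fin n → ℍ[ℝ])) (by simpa using hz0)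
  have hpair : IsOrthoPair v (r • (z : Fin n → ℍ[ℝ])) :=
    ⟨hv, hr, by rw [map_smul, h0, smul_zero], by rw [LinearMap.map_smul₂, h0', smul_zero]⟩
  have hmem : skewPair v (r • (z : Fin n → ℍ[ℝ])) ∈ g := by
    rw [map_smul]
    exact g.smul_mem _ hz
  obtain ⟨a, ha, b, hb, ha0, hab, hab0, hs⟩ := exists_isotropic hg hn hd hpair hmem
  obtain ⟨w, hw⟩ := exists_isSpFrame_of_isotropic hg hpair hmem ha hb ha0 hab hab0 hs
  exact eq_spAlg_of_frame hg hn hd hw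

open Filter Topology

section LieAlg

variable {A : Type*} [NormedRing A]

lemma norm_pow_sub_pow_le {g h : A} {C D : ℝ} {K : ℕ} (hg : ∀ k, ‖g ^ k‖ ≤ C)
    (hh : ∀ k ≤ K, ‖h ^ k‖ ≤ D) : ‖g ^ K - h ^ K‖ ≤ K * (C * ‖g - h‖ * D) := by
  have hC : 0 ≤ C := (norm_nonneg _).trans (hg 0)
  have key : ∀ m k, m + k ≤ K → ‖(g ^ m - h ^ m) * h ^ k‖ ≤ m * (C * ‖g - h‖ * D) := by
    intro m
    induction m with
    | zero => intro k _; simp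
    | succ m ih =>
      intro k hk
      have e : (g ^ (m + 1) - h ^ (m + 1)) * h ^ k
          = g ^ m * (g - h) * h ^ k + (g ^ m - h ^ m) * h ^ (k + 1) := by
        rw [pow_succ g, pow_succ h, pow_succ' h k]
        noncomm_ring
      rw [e]
      refine (norm_add_le _ _).trans ?_
      have h1 := ih (k + 1) (by omega)
      have h2 : ‖g ^ m * (g - h) * h ^ k‖ ≤ C * ‖g - h‖ * D := by
        refine (norm_mul_le _ _).trans (mul_le_mul ((norm_mul_le _ _).trans ?_) (hh k (by omega))
          (norm_nonneg _) (by positivity))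
        exact mul_le_mul_of_nonneg_right (hg m) (norm_nonneg _)
      push_cast
      linarith
  simpa using key K 0 le_rfl

/-- A closed bounded group of unitary elements. -/
structure IsUnitaryGroup [StarRing A] (G : Set A) : Prop where
  one_mem : 1 ∈ G
  mul_mem : ∀ a ∈ G, ∀ b ∈ G, a * b ∈ G
  star_mem : ∀ a ∈ G, star a ∈ G
  star_mul_self : ∀ a ∈ G, star a * a = 1
  isClosed : IsClosed G
  bounded : ∃ C, ∀ a ∈ G, ‖a‖ ≤ C

lemma IsUnitaryGroup.mul_star_self [StarRing A] {G : Set A} (hG : IsUnitaryGroup G) {a : A}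
    (ha : a ∈ G) :
    a * star a = 1 := by
  simpa using hG.star_mul_self _ (hG.star_mem a ha)

lemma IsUnitaryGroup.pow_mem [StarRing A] {G : Set A} (hG : IsUnitaryGroup G) {a : A}
    (ha : a ∈ G) (k : ℕ) : a ^ k ∈ G := by
  induction k with
  | zero => simpa using hG.one_mem
  | succ k ih => rw [pow_succ]; exact hG.mul_mem _ ih _ ha

lemma IsUnitaryGroup.inter [StarRing A] {G L : Set A} (hG : IsUnitaryGroup G)
    (hL : IsUnitaryGroup L) :
    IsUnitaryGroup (G ∩ L) where
  one_mem := ⟨hG.one_mem, hL.one_mem⟩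
  mul_mem a ha b hb := ⟨hG.mul_mem a ha.1 b hb.1, hL.mul_mem a ha.2 b hb.2⟩
  star_mem a ha := ⟨hG.star_mem a ha.1, hL.star_mem a ha.2⟩
  star_mul_self a ha := hG.star_mul_self a ha.1
  isClosed := hG.isClosed.inter hL.isClosed
  bounded := hG.bounded.imp fun _ hC a ha => hC a ha.1

variable [NormedAlgebra ℝ A]

lemma IsUnitaryGroup.isCompact [StarRing A] {G : Set A} [FiniteDimensional ℝ A]
    (hG : IsUnitaryGroup G) : IsCompact G := by
  have := FiniteDimensional.proper ℝ A
  obtain ⟨C, hC⟩ := hG.bounded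
  refine Metric.isCompact_of_isClosed_isBounded hG.isClosed ?_
  exact isBounded_iff_forall_norm_le.2 ⟨C, hC⟩

lemma deriv_mem_of_curve [FiniteDimensional ℝ A] {D : Submodule ℝ A} {c : ℝ → A} {X : A}
    (hc : ∀ t, c t ∈ D) (hX : HasDerivAt c X 0) : X ∈ D := by
  refine D.closed_of_finiteDimensional.mem_of_tendsto (hasDerivAt_iff_tendsto_slope_zero.1 hX)
    (Eventually.of_forall fun t => ?_)
  exact D.smul_mem _ (D.sub_mem (hc _) (hc _))

lemma exp_zero_smul (X : A) : NormedSpace.exp ((0 : ℝ) • X) = 1 := by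
  rw [zero_smul, NormedSpace.exp_zero]

variable [CompleteSpace A]

lemma exp_add_smul (X : A) (s t : ℝ) :
    NormedSpace.exp ((s + t) • X) = NormedSpace.exp (s • X) * NormedSpace.exp (t • X) := by
  let := NormedAlgebra.restrictScalars ℚ ℝ A
  rw [add_smul]
  exact NormedSpace.exp_add_of_commute
    (((Commute.refl X).smul_left s).smul_right t)

lemma exp_nat_mul_smul (X : A) (m : ℕ) (t : ℝ) :
    NormedSpace.exp ((m * t) • X) = NormedSpace.exp (t • X) ^ m := by
  let := NormedAlgebra.restrictScalars ℚ ℝ A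
  rw [← NormedSpace.exp_nsmul, mul_smul, Nat.cast_smul_eq_nsmul]

lemma exp_mul_exp_neg (X : A) (s : ℝ) :
    NormedSpace.exp (s • X) * NormedSpace.exp ((-s) • X) = 1 := by
  rw [← exp_add_smul, add_neg_cancel, exp_zero_smul]

lemma continuous_exp_smul (X : A) : Continuous fun s : ℝ => NormedSpace.exp (s • X) :=
  continuous_iff_continuousAt.2 fun s => (hasDerivAt_exp_smul_const X s).continuousAt

lemma hasDerivAt_exp_smul_zero (X : A) :
    HasDerivAt (fun s : ℝ => NormedSpace.exp (s • X)) X 0 := by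
  simpa using hasDerivAt_exp_smul_const X (0 : ℝ)

variable [StarRing A]

variable {G : Set A}

/-- A limit of difference quotients of group elements generates a one-parameter subgroup. -/
lemma IsUnitaryGroup.exp_mem (hG : IsUnitaryGroup G) {ι : Type*} {F : Filter ι} [F.NeBot]
    {g : ι → A} {ρ : ι → ℝ} {X : A} (hg : ∀ᶠ i in F, g i ∈ G) (hρ : ∀ᶠ i in F, 0 < ρ i)
    (hρ0 : Tendsto ρ F (𝓝 0)) (hX : Tendsto (fun i => (ρ i)⁻¹ • (g i - 1)) F (𝓝 X)) (s : ℝ) :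
    NormedSpace.exp (s • X) ∈ G := by
  have main : ∀ s : ℝ, 0 ≤ s → NormedSpace.exp (s • X) ∈ G := by
    intro s hs
    obtain ⟨C, hC⟩ := hG.bounded
    obtain ⟨D, hD⟩ := (isCompact_Icc (a := (0 : ℝ)) (b := s)).exists_bound_of_continuousOn
      (continuous_exp_smul X).continuousOn
    have hC0 : 0 ≤ C := (norm_nonneg _).trans (hC 1 hG.one_mem)
    have hD0 : 0 ≤ D := (norm_nonneg _).trans (hD 0 ⟨le_rfl, hs⟩)
    have hm : Tendsto (fun i => (⌊s / ρ i⌋₊ : ℝ) * ρ i) F (𝓝 s) := by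
      have h1 : Tendsto (fun i => s - ρ i) F (𝓝 s) := by simpa using hρ0.const_sub s
      refine tendsto_of_tendsto_of_tendsto_of_le_of_le' h1 tendsto_const_nhds ?_ ?_
      · filter_upwards [hρ] with i hi
        have := Nat.lt_floor_add_one (s / ρ i)
        rw [div_lt_iff₀ hi] at this
        linarith
      · filter_upwards [hρ] with i hi
        have := Nat.floor_le (div_nonneg hs hi.le)
        rwa [le_div_iff₀ hi] at this
    have hE : Tendsto (fun i => NormedSpace.exp (((⌊s / ρ i⌋₊ : ℝ) * ρ i) • X)) F
        (𝓝 (NormedSpace.exp (s • X))) := ((continuous_exp_smul X).tendsto s).comp hm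
    have hρ0' : Tendsto ρ F (𝓝[≠] 0) :=
      tendsto_nhdsWithin_iff.2 ⟨hρ0, hρ.mono fun i hi => ne_of_gt hi⟩
    have hq : Tendsto (fun i => (ρ i)⁻¹ • (NormedSpace.exp (ρ i • X) - 1)) F (𝓝 X) := by
      have := (hasDerivAt_iff_tendsto_slope_zero.1 (hasDerivAt_exp_smul_zero X)).comp hρ0'
      simpa [Function.comp_def] using this
    have hd : Tendsto (fun i => ‖(ρ i)⁻¹ • (g i - NormedSpace.exp (ρ i • X))‖) F (𝓝 0) := by
      have := (hX.sub hq).norm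
      rw [sub_self, norm_zero] at this
      refine this.congr fun i => ?_
      rw [← smul_sub, sub_sub_sub_cancel_right]
    have hdiff : Tendsto (fun i => g i ^ ⌊s / ρ i⌋₊
        - NormedSpace.exp (((⌊s / ρ i⌋₊ : ℝ) * ρ i) • X)) F (𝓝 0) := by
      have h0 : Tendsto (fun i => s * C * D * ‖(ρ i)⁻¹ • (g i - NormedSpace.exp (ρ i • X))‖) F
          (𝓝 0) := by simpa using hd.const_mul (s * C * D)
      refine squeeze_zero_norm' ?_ h0
      filter_upwards [hg, hρ] with i hgi hi
      have hfl := Nat.floor_le (div_nonneg hs hi.le)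
      rw [exp_nat_mul_smul]
      refine (norm_pow_sub_pow_le (fun k => hC _ (hG.pow_mem hgi k)) (D := D) ?_).trans ?_
      · intro k hk
        rw [← exp_nat_mul_smul]
        refine hD _ ⟨by positivity, ?_⟩
        rw [← le_div_iff₀ hi]
        exact (Nat.cast_le.2 hk).trans hfl
      · rw [norm_smul, norm_inv, Real.norm_of_nonneg hi.le]
        calc (⌊s / ρ i⌋₊ : ℝ) * (C * ‖g i - NormedSpace.exp (ρ i • X)‖ * D)
            ≤ s / ρ i * (C * ‖g i - NormedSpace.exp (ρ i • X)‖ * D) :=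
              mul_le_mul_of_nonneg_right hfl (by positivity)
          _ = _ := by ring
    have hlim : Tendsto (fun i => g i ^ ⌊s / ρ i⌋₊) F (𝓝 (NormedSpace.exp (s • X))) := by
      simpa using hdiff.add hE
    exact hG.isClosed.mem_of_tendsto hlim (hg.mono fun i hi => hG.pow_mem hi _)
  rcases le_total 0 s with hs | hs
  · exact main s hs
  · have h1 := main (-s) (by linarith)
    have h2 := exp_mul_exp_neg X (-s)
    rw [neg_neg] at h2
    have h3 : NormedSpace.exp (s • X) = star (NormedSpace.exp ((-s) • X)) := by
      rw [← one_mul (NormedSpace.exp (s • X)), ← hG.star_mul_self _ h1, mul_assoc, h2, mul_one]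
    rw [h3]
    exact hG.star_mem _ h1

/-- Velocities of curves in the group generate one-parameter subgroups. -/
lemma IsUnitaryGroup.exp_mem_of_curve (hG : IsUnitaryGroup G) {c : ℝ → A} {X : A}
    (hc : ∀ t, c t ∈ G) (hc0 : c 0 = 1) (hX : HasDerivAt c X 0) (s : ℝ) :
    NormedSpace.exp (s • X) ∈ G := by
  refine hG.exp_mem (F := 𝓝[>] (0 : ℝ)) (g := c) (ρ := id) (Eventually.of_forall hc)
    self_mem_nhdsWithin (tendsto_id.mono_left nhdsWithin_le_nhds) ?_ s
  have h1 := (hasDerivAt_iff_tendsto_slope_zero.1 hX).mono_left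
    (nhdsWithin_mono (0 : ℝ) fun x (hx : x ∈ Set.Ioi 0) => ne_of_gt hx)
  simpa [hc0] using h1

/-- The Lie algebra of a closed group of unitary elements. -/
def lieAlg (hG : IsUnitaryGroup G) : Submodule ℝ A where
  carrier := {X | ∀ s : ℝ, NormedSpace.exp (s • X) ∈ G}
  zero_mem' s := by simpa using hG.one_mem
  smul_mem' r X hX s := by
    rw [smul_smul]
    exact hX _
  add_mem' {X Y} hX hY s := by
    refine hG.exp_mem_of_curve (c := fun t => NormedSpace.exp (t • X) * NormedSpace.exp (t • Y))
      (fun t => hG.mul_mem _ (hX t) _ (hY t)) (by simp) ?_ s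
    exact ((hasDerivAt_exp_smul_zero X).mul (hasDerivAt_exp_smul_zero Y)).congr_deriv (by simp)

lemma mem_lieAlg_of_curve {hG : IsUnitaryGroup G} {c : ℝ → A} {X : A}
    (hc : ∀ t, c t ∈ G) (hc0 : c 0 = 1) (hX : HasDerivAt c X 0) : X ∈ lieAlg hG :=
  hG.exp_mem_of_curve hc hc0 hX

lemma lieAlg_bracket [FiniteDimensional ℝ A] (hG : IsUnitaryGroup G) {X Y : A}
    (hX : X ∈ lieAlg hG) (hY : Y ∈ lieAlg hG) : X * Y - Y * X ∈ lieAlg hG := by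
  refine deriv_mem_of_curve (c := fun s => NormedSpace.exp (s • X) * Y
    * NormedSpace.exp ((-s) • X)) (fun s => ?_) ?_
  · refine mem_lieAlg_of_curve (c := fun t => NormedSpace.exp (s • X) * NormedSpace.exp (t • Y)
      * NormedSpace.exp ((-s) • X)) (fun t => ?_) ?_ ?_
    · exact hG.mul_mem _ (hG.mul_mem _ (hX s) _ (hY t)) _ (hX (-s))
    · simp only [exp_zero_smul, mul_one, exp_mul_exp_neg]
    · exact ((hasDerivAt_exp_smul_zero Y).const_mul _).mul_const _
  · have h1 := hasDerivAt_exp_smul_zero X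
    have h2 := hasDerivAt_exp_smul_zero (-X)
    simp only [smul_neg, ← neg_smul] at h2
    exact ((h1.mul_const Y).mul h2).congr_deriv (by simp [sub_eq_add_neg])

lemma star_eq_neg_of_mem_lieAlg [ContinuousStar A] (hG : IsUnitaryGroup G) {X : A}
    (hX : X ∈ lieAlg hG) : star X = -X := by
  have h : ∀ s : ℝ, star (NormedSpace.exp (s • X)) = NormedSpace.exp ((-s) • X) := fun s => by
    rw [← mul_one (star _), ← exp_mul_exp_neg X s, ← mul_assoc, hG.star_mul_self _ (hX s), one_mul]
  have h1 := hasDerivAt_iff_tendsto_slope_zero.1 (hasDerivAt_exp_smul_zero X)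
  have h2 := hasDerivAt_iff_tendsto_slope_zero.1 (hasDerivAt_exp_smul_zero (-X))
  refine tendsto_nhds_unique ((continuous_star.tendsto X).comp h1) (h2.congr fun t => ?_)
  have e : ∀ (r : ℝ) (Z : A), star (r • Z) = r • star Z := fun r Z =>
    map_real_smul (starAddEquiv : A ≃+ A) continuous_star r Z
  simp only [Function.comp_def, zero_add, e, star_sub, h, star_one, smul_neg,
    neg_smul, zero_smul, neg_zero, NormedSpace.exp_zero]

end LieAlg

section Orbit

variable {A : Type*} [NormedRing A] [NormedAlgebra ℝ A] [StarRing A]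

/-- A linear form with the positivity properties of the real part of the trace. -/
structure IsTraceForm (τ : A →ₗ[ℝ] ℝ) : Prop where
  apply_star : ∀ x, τ (star x) = τ x
  eq_zero : ∀ x, τ (star x * x) ≤ 0 → x = 0

lemma IsTraceForm.eq_one {τ : A →ₗ[ℝ] ℝ} (hτ : IsTraceForm τ) {a : A} (ha : star a * a = 1)
    (h : τ 1 ≤ τ a) : a = 1 := by
  refine sub_eq_zero.1 (hτ.eq_zero _ ?_)
  have e : star (a - 1) * (a - 1) = (1 - star a) + (1 - a) := by
    rw [star_sub, star_one, sub_mul, mul_sub, ha]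
    noncomm_ring
  rw [e, map_add, map_sub, map_sub, hτ.apply_star]
  linarith

variable [FiniteDimensional ℝ A] {G L : Set A}

/-- Decomposition of the elements of `G L` with the `G`-component closest to the identity. -/
lemma exists_factor_max (hG : IsUnitaryGroup G) (hL : IsUnitaryGroup L) (τ : A →ₗ[ℝ] ℝ) {p : A}
    (hp : ∃ g ∈ G, ∃ l ∈ L, p = g * l) :
    ∃ g ∈ G, ∃ l ∈ L, p = g * l ∧ ∀ s ∈ G ∩ L, τ (g * s) ≤ τ g := by
  obtain ⟨g, hg, l, hl, rfl⟩ := hp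
  have hS := hG.inter hL
  have hτ : Continuous fun s => τ (g * s) :=
    τ.continuous_of_finiteDimensional.comp (continuous_const_mul g)
  obtain ⟨s, hs, hmax⟩ := hS.isCompact.exists_isMaxOn ⟨1, hS.one_mem⟩ hτ.continuousOn
  refine ⟨g * s, hG.mul_mem _ hg _ hs.1, star s * l, hL.mul_mem _ (hL.star_mem _ hs.2) _ hl, ?_,
    fun r hr => ?_⟩
  · rw [mul_assoc, ← mul_assoc s, hS.mul_star_self hs, one_mul]
  · rw [mul_assoc]
    exact hmax (hS.mul_mem _ hs _ hr)

variable [CompleteSpace A]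

/-- First order condition at a maximum of a linear form on a coset. -/
lemma apply_mul_eq_zero_of_max (hG : IsUnitaryGroup G) (σ : A →ₗ[ℝ] ℝ)
    (hmax : ∀ g ∈ G, σ g ≤ σ 1) {X : A} (hX : X ∈ lieAlg hG) : σ X = 0 := by
  have h1 : HasDerivAt (fun s : ℝ => σ (NormedSpace.exp (s • X))) (σ X) 0 :=
    σ.toContinuousLinearMap.hasFDerivAt.comp_hasDerivAt 0 (hasDerivAt_exp_smul_zero X)
  refine IsLocalMax.hasDerivAt_eq_zero (Eventually.of_forall fun s => ?_) h1
  simpa using hmax _ (hX s)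

lemma mem_sup_lieAlg_of_curve [ContinuousStar A] (hG : IsUnitaryGroup G) (hL : IsUnitaryGroup L)
    {τ : A →ₗ[ℝ] ℝ} (hτ : IsTraceForm τ) {p : ℝ → A} {W : A}
    (hp : ∀ t, ∃ g ∈ G, ∃ l ∈ L, p t = g * l) (hp0 : p 0 = 1) (hW : HasDerivAt p W 0) :
    W ∈ lieAlg hG ⊔ lieAlg hL := by
  have hS := hG.inter hL
  have hτc : Continuous τ := τ.continuous_of_finiteDimensional
  choose g hg l hl hgl hmax using fun t => exists_factor_max hG hL τ (hp t)
  let U : Ultrafilter ℝ := Ultrafilter.of (𝓝[>] (0 : ℝ))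
  have hU : (U : Filter ℝ) ≤ 𝓝[>] 0 := Ultrafilter.of_le _
  have hU0 : Tendsto (fun t : ℝ => t) U (𝓝 0) := hU.trans nhdsWithin_le_nhds
  have hpos : ∀ᶠ t : ℝ in U, 0 < t := hU self_mem_nhdsWithin
  have hpU : Tendsto p U (𝓝 1) := by
    have := hW.continuousAt.tendsto.comp hU0
    rwa [hp0] at this
  -- the `G`-components converge to the identity
  obtain ⟨g₀, hg₀, hlim⟩ := hG.isCompact.ultrafilter_le_nhds' (U.map g)
    (Ultrafilter.mem_map.2 (Filter.univ_mem' hg))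
  have hlim : Tendsto g U (𝓝 g₀) := hlim
  have hl_eq : ∀ t, l t = star (g t) * p t := fun t => by
    rw [hgl, ← mul_assoc, hG.star_mul_self _ (hg t), one_mul]
  have hstar : Tendsto (fun t => star (g t)) U (𝓝 (star g₀)) :=
    (continuous_star.tendsto g₀).comp hlim
  have hg₀L : star g₀ ∈ L := by
    have : Tendsto l U (𝓝 (star g₀)) := by
      have := hstar.mul hpU
      rw [mul_one] at this
      exact this.congr fun t => (hl_eq t).symm
    exact hL.isClosed.mem_of_tendsto this (Eventually.of_forall hl)
  have hg₀1 : g₀ = 1 := by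
    refine hτ.eq_one (hG.star_mul_self _ hg₀) ?_
    have h1 : Tendsto (fun t => τ (g t * star g₀)) U (𝓝 (τ (g₀ * star g₀))) :=
      (hτc.tendsto _).comp (hlim.mul_const _)
    rw [hG.mul_star_self hg₀] at h1
    exact le_of_tendsto_of_tendsto' h1 ((hτc.tendsto _).comp hlim)
      fun t => hmax t _ ⟨hG.star_mem _ hg₀, hg₀L⟩
  rw [hg₀1] at hlim hstar
  rw [star_one] at hstar
  -- rescale
  let ρ : ℝ → ℝ := fun t => ‖g t - 1‖ + t
  have hρ : ∀ᶠ t in U, 0 < ρ t := hpos.mono fun t ht => add_pos_of_nonneg_of_pos (norm_nonneg _) ht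
  have hρ0 : Tendsto ρ U (𝓝 0) := by
    have h1 := (hlim.sub_const 1).norm
    rw [sub_self, norm_zero] at h1
    simpa using h1.add hU0
  have := FiniteDimensional.proper ℝ A
  obtain ⟨X, -, hX⟩ := (isCompact_closedBall (0 : A) 1).ultrafilter_le_nhds'
    (U.map fun t => (ρ t)⁻¹ • (g t - 1)) (Ultrafilter.mem_map.2 (by
      filter_upwards [hρ, hpos] with t ht ht0
      rw [Set.mem_preimage, mem_closedBall_zero_iff, norm_smul, norm_inv,
        Real.norm_of_nonneg ht.le, inv_mul_le_one₀ ht]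
      exact le_add_of_nonneg_right ht0.le))
  have hX : Tendsto (fun t => (ρ t)⁻¹ • (g t - 1)) U (𝓝 X) := hX
  obtain ⟨θ, -, hθ⟩ := (isCompact_Icc (a := (0 : ℝ)) (b := 1)).ultrafilter_le_nhds'
    (U.map fun t => (ρ t)⁻¹ * t) (Ultrafilter.mem_map.2 (by
      filter_upwards [hρ, hpos] with t ht ht0
      exact ⟨by positivity, by
        rw [inv_mul_le_one₀ ht]
        exact le_add_of_nonneg_left (norm_nonneg _)⟩))
  have hθ : Tendsto (fun t => (ρ t)⁻¹ * t) U (𝓝 θ) := hθ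
  have hXG : X ∈ lieAlg hG := fun s => hG.exp_mem (Eventually.of_forall hg) hρ hρ0 hX s
  have hpq : Tendsto (fun t => (ρ t)⁻¹ • (p t - 1)) U (𝓝 (θ • W)) := by
    have h1 : Tendsto (fun t : ℝ => t⁻¹ • (p t - 1)) U (𝓝 W) := by
      have h2 := (hasDerivAt_iff_tendsto_slope_zero.1 hW).mono_left (hU.trans
        (nhdsWithin_mono (0 : ℝ) fun x (hx : x ∈ Set.Ioi 0) => ne_of_gt hx))
      simpa [hp0] using h2
    refine (hθ.smul h1).congr' ?_
    filter_upwards [hpos] with t ht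
    rw [smul_smul, mul_assoc, mul_inv_cancel₀ ht.ne', mul_one]
  have hYL : θ • W - X ∈ lieAlg hL := by
    refine fun s => hL.exp_mem (Eventually.of_forall hl) hρ hρ0 ?_ s
    have h1 := hstar.mul (hpq.sub hX)
    rw [one_mul] at h1
    refine h1.congr fun t => ?_
    rw [← smul_sub, sub_sub_sub_cancel_right, mul_smul_comm, mul_sub, ← hl_eq,
      hG.star_mul_self _ (hg t)]
  rcases eq_or_ne θ 0 with h0 | h0
  · exfalso
    rw [h0, zero_smul, zero_sub, Submodule.neg_mem_iff] at hYL
    have hXS : X ∈ lieAlg hS := fun s => ⟨hXG s, hYL s⟩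
    have hskew := star_eq_neg_of_mem_lieAlg hG hXG
    have hτX : τ X = 0 := by
      have := hτ.apply_star X
      rw [hskew, map_neg] at this
      linarith
    have hfirst : ∀ t, τ (g t * X) = 0 := fun t =>
      apply_mul_eq_zero_of_max hS (τ ∘ₗ LinearMap.mulLeft ℝ (g t))
        (fun s hs => by simpa using hmax t s hs) hXS
    have hXX : τ (X * X) = 0 := by
      have h1 : Tendsto (fun t => τ (((ρ t)⁻¹ • (g t - 1)) * X)) U (𝓝 (τ (X * X))) :=
        (hτc.tendsto _).comp (hX.mul_const X)
      refine tendsto_nhds_unique h1 (tendsto_const_nhds.congr fun t => ?_)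
      rw [smul_mul_assoc, map_smul, sub_mul, map_sub, hfirst, one_mul, hτX, sub_zero, smul_zero]
    have hX0 : X = 0 := hτ.eq_zero X (by rw [hskew, neg_mul, map_neg, hXX, neg_zero])
    have hn : Tendsto (fun t => ‖(ρ t)⁻¹ • (g t - 1)‖ + (ρ t)⁻¹ * t) U (𝓝 (‖X‖ + θ)) :=
      hX.norm.add hθ
    rw [hX0, norm_zero, h0, add_zero] at hn
    have hone : Tendsto (fun t => ‖(ρ t)⁻¹ • (g t - 1)‖ + (ρ t)⁻¹ * t) U (𝓝 1) := by
      refine tendsto_const_nhds.congr' ?_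
      filter_upwards [hρ] with t ht
      rw [norm_smul, norm_inv, Real.norm_of_nonneg ht.le, ← mul_add, inv_mul_cancel₀ ht.ne']
    exact zero_ne_one (tendsto_nhds_unique hn hone)
  · have e : W = θ⁻¹ • (X + (θ • W - X)) := by
      rw [add_sub_cancel, smul_smul, inv_mul_cancel₀ h0, one_smul]
    rw [e]
    exact Submodule.smul_mem _ _ (Submodule.add_mem_sup hXG hYL)

end Orbit

section Matrices

attribute [local instance] Matrix.linftyOpNormedRing Matrix.linftyOpNormedAlgebra

/-- `ContinuousStar` with its operation taken from the `StarRing` structure over a normed ring. -/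
abbrev HasContinuousStar (A : Type*) [NormedRing A] [StarRing A] : Prop := ContinuousStar A

instance continuousStar_matrix : HasContinuousStar (Matrix (Fin n) (Fin n) ℍ[ℝ]) :=
  ⟨ContinuousStar.continuous_star (R := Matrix (Fin n) (Fin n) ℍ[ℝ])⟩

/-- The real part of the trace of a quaternionic matrix. -/
def reTrace (n : ℕ) : Matrix (Fin n) (Fin n) ℍ[ℝ] →ₗ[ℝ] ℝ where
  toFun A := ∑ i, (A i i).re
  map_add' A B := by simp [Finset.sum_add_distrib]
  map_smul' r A := by simp [Finset.mul_sum]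

lemma reTrace_apply (A : Matrix (Fin n) (Fin n) ℍ[ℝ]) : reTrace n A = ∑ i, (A i i).re := rfl

lemma re_star_mul_self_apply (A : Matrix (Fin n) (Fin n) ℍ[ℝ]) (j : Fin n) :
    ((star A * A) j j).re = ∑ i, ‖A i j‖ ^ 2 := by
  have h : ((star A * A) j j) = ((∑ i, ‖A i j‖ ^ 2 : ℝ) : ℍ[ℝ]) := by
    simp only [Matrix.mul_apply, Matrix.star_apply, Quaternion.star_mul_self,
      Quaternion.normSq_eq_norm_mul_self, ← pow_two]
    exact (map_sum (algebraMap ℝ ℍ[ℝ]) _ _).symm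
  rw [h, Quaternion.re_coe]

lemma isTraceForm_reTrace : IsTraceForm (reTrace n) where
  apply_star A := by simp [reTrace_apply, Matrix.star_apply]
  eq_zero A h := by
    simp only [reTrace_apply, re_star_mul_self_apply] at h
    have h0 := h.antisymm (Finset.sum_nonneg fun j _ => Finset.sum_nonneg fun i _ => by positivity)
    rw [Finset.sum_eq_zero_iff_of_nonneg
      fun j _ => Finset.sum_nonneg fun i _ => by positivity] at h0
    ext1 i j
    have h1 := h0 j (Finset.mem_univ _)
    rw [Finset.sum_eq_zero_iff_of_nonneg fun i _ => by positivity] at h1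
    simpa using h1 i (Finset.mem_univ _)

lemma norm_apply_le_one {A : Matrix (Fin n) (Fin n) ℍ[ℝ]} (hA : star A * A = 1) (i j : Fin n) :
    ‖A i j‖ ≤ 1 := by
  have h := re_star_mul_self_apply A j
  rw [hA, Matrix.one_apply_eq, Quaternion.re_one] at h
  have := Finset.single_le_sum (f := fun i => ‖A i j‖ ^ 2) (fun i _ => by positivity)
    (Finset.mem_univ i)
  nlinarith [norm_nonneg (A i j)]

lemma norm_le_of_star_mul_self {A : Matrix (Fin n) (Fin n) ℍ[ℝ]} (hA : star A * A = 1) :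
    ‖A‖ ≤ n := by
  rw [Matrix.linfty_opNorm_def]
  have : (Finset.univ.sup fun i => ∑ j, ‖A i j‖₊) ≤ (n : NNReal) := by
    refine Finset.sup_le fun i _ => ?_
    refine (Finset.sum_le_card_nsmul _ _ 1 fun j _ => ?_).trans (by simp)
    exact norm_apply_le_one hA i j
  exact_mod_cast this

lemma isUnitaryGroup_of_subset {G : Set (Matrix (Fin n) (Fin n) ℍ[ℝ])} (hG : G ⊆ SpSet n)
    (hgrp : IsMatSubgroup G) (hcl : IsClosed G) : IsUnitaryGroup G where
  one_mem := hgrp.1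
  mul_mem := hgrp.2.1
  star_mem := hgrp.2.2
  star_mul_self _ ha := (hG ha).1
  isClosed := hcl
  bounded := ⟨n, fun _ ha => norm_le_of_star_mul_self (hG ha).1⟩

lemma isMatSubgroup_spSet : IsMatSubgroup (SpSet n) := by
  refine ⟨⟨by simp, by simp⟩, fun a ha b hb => ⟨?_, ?_⟩, fun a ha => ⟨?_, ?_⟩⟩
  · rw [star_mul, mul_assoc, ← mul_assoc (star a), ha.1, one_mul, hb.1]
  · rw [star_mul, mul_assoc, ← mul_assoc b, hb.2, one_mul, ha.2]
  · rw [star_star, ha.2]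
  · rw [star_star, ha.1]

lemma diagSp1_subset : diagSp1 n ⊆ SpSet n := by
  rintro _ ⟨q, hq, rfl⟩
  have h1 : ∀ i, star (q i) * q i = 1 := fun i => (Unitary.mem_iff.1 (hq i)).1
  have h2 : ∀ i, q i * star (q i) = 1 := fun i => (Unitary.mem_iff.1 (hq i)).2
  constructor <;>
  · rw [Matrix.star_eq_conjTranspose, Matrix.diagonal_conjTranspose, Matrix.diagonal_mul_diagonal]
    simp [h1, h2]

lemma mem_diagSp1 {A : Matrix (Fin n) (Fin n) ℍ[ℝ]} :
    A ∈ diagSp1 n ↔ star A * A = 1 ∧ ∀ i j, i ≠ j → A i j = 0 := by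
  constructor
  · intro hA
    refine ⟨(diagSp1_subset hA).1, ?_⟩
    obtain ⟨q, -, rfl⟩ := hA
    exact fun i j hij => Matrix.diagonal_apply_ne _ hij
  · rintro ⟨h1, h⟩
    have hA : A = Matrix.diagonal fun i => A i i := by
      ext1 i j
      rcases eq_or_ne i j with rfl | hij
      · simp
      · rw [h i j hij, Matrix.diagonal_apply_ne _ hij]
    have h2 := mul_eq_one_comm.1 h1
    rw [hA, Matrix.star_eq_conjTranspose, Matrix.diagonal_conjTranspose,
      Matrix.diagonal_mul_diagonal] at h1 h2
    refine ⟨fun i => A i i, fun i => Unitary.mem_iff.2 ⟨?_, ?_⟩, hA⟩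
    · simpa using congrFun (congrFun h1 i) i
    · simpa using congrFun (congrFun h2 i) i

lemma isMatSubgroup_diagSp1 : IsMatSubgroup (diagSp1 n) := by
  refine ⟨mem_diagSp1.2 ⟨by simp, fun i j hij => Matrix.one_apply_ne hij⟩, fun a ha b hb => ?_,
    fun a ha => ?_⟩
  · refine mem_diagSp1.2 ⟨(isMatSubgroup_spSet.2.1 _ (diagSp1_subset ha) _
      (diagSp1_subset hb)).1, fun i j hij => ?_⟩
    rw [Matrix.mul_apply]
    refine Finset.sum_eq_zero fun l _ => ?_
    rcases eq_or_ne i l with rfl | hil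
    · rw [(mem_diagSp1.1 hb).2 _ _ hij, mul_zero]
    · rw [(mem_diagSp1.1 ha).2 _ _ hil, zero_mul]
  · refine mem_diagSp1.2 ⟨(isMatSubgroup_spSet.2.2 _ (diagSp1_subset ha)).1, fun i j hij => ?_⟩
    rw [Matrix.star_apply, (mem_diagSp1.1 ha).2 _ _ hij.symm, star_zero]

lemma isClosed_diagSp1 : IsClosed (diagSp1 n) := by
  have : diagSp1 n = {A | star A * A = 1} ∩ ⋂ (i) (j) (_ : i ≠ j), {A | A i j = 0} := by
    ext A
    simp [mem_diagSp1]
  rw [this]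
  refine (isClosed_eq (by fun_prop) continuous_const).inter ?_
  refine isClosed_iInter fun i => isClosed_iInter fun j => isClosed_iInter fun _ => ?_
  exact isClosed_eq (continuous_id.matrix_elem i j) continuous_const

/-- The conjugate `k H k*` of the diagonal group. -/
def conjDiag (k : Matrix (Fin n) (Fin n) ℍ[ℝ]) : Set (Matrix (Fin n) (Fin n) ℍ[ℝ]) :=
  {l | star k * l * k ∈ diagSp1 n}

variable {k : Matrix (Fin n) (Fin n) ℍ[ℝ]}

lemma isUnitaryGroup_conjDiag (hk : k ∈ SpSet n) : IsUnitaryGroup (conjDiag k) := by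
  refine isUnitaryGroup_of_subset (fun l hl => ?_) ⟨?_, fun a ha b hb => ?_, fun a ha => ?_⟩ ?_
  · have e : l = k * (star k * l * k) * star k := by
      rw [mul_assoc, mul_assoc, hk.2, mul_one, ← mul_assoc, hk.2, one_mul]
    rw [e]
    exact isMatSubgroup_spSet.2.1 _ (isMatSubgroup_spSet.2.1 _ hk _ (diagSp1_subset hl)) _
      (isMatSubgroup_spSet.2.2 _ hk)
  · change star k * 1 * k ∈ diagSp1 n
    rw [mul_one, hk.1]
    exact isMatSubgroup_diagSp1.1
  · have e : star k * (a * b) * k = (star k * a * k) * (star k * b * k) := by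
      rw [show star k * a * k * (star k * b * k) = star k * a * (k * star k) * b * k by
        noncomm_ring, hk.2, mul_one]
      noncomm_ring
    change star k * (a * b) * k ∈ diagSp1 n
    rw [e]
    exact isMatSubgroup_diagSp1.2.1 _ ha _ hb
  · have := isMatSubgroup_diagSp1.2.2 _ ha
    rwa [star_mul, star_mul, star_star, ← mul_assoc] at this
  · exact isClosed_diagSp1.preimage (by fun_prop)

lemma isLieSubalg_lieAlg {G : Set (Matrix (Fin n) (Fin n) ℍ[ℝ])} (hG : IsUnitaryGroup G) :
    IsLieSubalg (lieAlg hG) where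
  le _ hX := star_eq_neg_of_mem_lieAlg hG hX
  bracket _ hX _ hY := lieAlg_bracket hG hX hY

lemma finrank_imH_le : finrank ℝ imH ≤ 3 := by
  have h : finrank ℝ imH < finrank ℝ ℍ[ℝ] := by
    refine Submodule.finrank_lt fun h => ?_
    have : (1 : ℍ[ℝ]) ∈ imH := by rw [h]; trivial
    rw [mem_imH, Quaternion.re_one] at this
    exact one_ne_zero this
  rw [Quaternion.finrank_eq_four] at h
  omega

lemma finrank_lieAlg_conjDiag (hk : k ∈ SpSet n) :
    finrank ℝ (lieAlg (isUnitaryGroup_conjDiag hk)) ≤ 3 * n := by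
  let φ : Matrix (Fin n) (Fin n) ℍ[ℝ] →ₗ[ℝ] Matrix (Fin n) (Fin n) ℍ[ℝ] :=
    LinearMap.mulRight ℝ k ∘ₗ LinearMap.mulLeft ℝ (star k)
  have hφ : ∀ X, φ X = star k * X * k := fun _ => rfl
  have hinj : Function.Injective φ := by
    refine Function.LeftInverse.injective (g := fun Y => k * Y * star k) fun X => ?_
    change k * φ X * star k = X
    rw [hφ, mul_assoc, mul_assoc, hk.2, mul_one, ← mul_assoc, hk.2, one_mul]
  let δ : (Fin n → imH) →ₗ[ℝ] Matrix (Fin n) (Fin n) ℍ[ℝ] :=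
    Matrix.diagonalLinearMap (Fin n) ℝ ℍ[ℝ] ∘ₗ LinearMap.pi fun i => imH.subtype ∘ₗ LinearMap.proj i
  have hle : (lieAlg (isUnitaryGroup_conjDiag hk)).map φ ≤ LinearMap.range δ := by
    rintro _ ⟨X, hX, rfl⟩
    have hd : φ X ∈ LinearMap.range (Matrix.diagonalLinearMap (Fin n) ℝ ℍ[ℝ]) := by
      refine deriv_mem_of_curve (c := fun t => star k * NormedSpace.exp (t • X) * k) (fun t => ?_)
        (((hasDerivAt_exp_smul_zero X).const_mul _).mul_const _)
      obtain ⟨q, -, hq⟩ := hX t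
      exact ⟨q, hq.symm⟩
    have hs : star (φ X) = -φ X := by
      rw [hφ, star_mul, star_mul, star_star,
        star_eq_neg_of_mem_lieAlg (isUnitaryGroup_conjDiag hk) hX]
      noncomm_ring
    obtain ⟨q, hq⟩ := hd
    have hq : Matrix.diagonal q = φ X := hq
    rw [← hq] at hs ⊢
    refine ⟨fun i => ⟨q i, ?_⟩, rfl⟩
    have := congrArg (fun q => q.re) (congrFun (congrFun hs i) i)
    simp only [Matrix.star_apply, Matrix.diagonal_apply_eq, Matrix.neg_apply, Quaternion.re_star,
      Quaternion.re_neg] at this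
    rw [mem_imH]
    linarith
  calc finrank ℝ (lieAlg (isUnitaryGroup_conjDiag hk))
      = finrank ℝ ((lieAlg (isUnitaryGroup_conjDiag hk)).map φ) :=
        (LinearEquiv.finrank_eq (Submodule.equivMapOfInjective φ hinj _))
    _ ≤ finrank ℝ (LinearMap.range δ) := Submodule.finrank_mono hle
    _ ≤ finrank ℝ (Fin n → imH) := LinearMap.finrank_range_le _
    _ ≤ 3 * n := by
      rw [Module.finrank_pi_fintype, Finset.sum_const, Finset.card_univ, Fintype.card_fin,
        smul_eq_mul, mul_comm]
      exact Nat.mul_le_mul_right _ finrank_imH_le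

lemma hasDerivAt_matrix {c : ℝ → Matrix (Fin n) (Fin n) ℍ[ℝ]} {w : Matrix (Fin n) (Fin n) ℍ[ℝ]}
    {t : ℝ} : HasDerivAt c w t ↔ ∀ i j, HasDerivAt (fun s => c s i j) (w i j) t := by
  constructor
  · intro h i j
    exact hasDerivAt_iff_tendsto_slope_zero.2
      (((continuous_id.matrix_elem i j).tendsto w).comp (hasDerivAt_iff_tendsto_slope_zero.1 h))
  · intro h
    have h1 := fun i j => hasDerivAt_iff_tendsto_slope_zero.1 (h i j)
    have h2 : Tendsto (fun s : ℝ => s⁻¹ • (c (t + s) - c t)) (𝓝[≠] 0) (𝓝 w) :=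
      tendsto_pi_nhds.2 fun i => tendsto_pi_nhds.2 fun j => h1 i j
    exact hasDerivAt_iff_tendsto_slope_zero.2 h2

lemma finrank_spAlg_le_grpDim : finrank ℝ (spAlg n) ≤ grpDim (SpSet n) := by
  refine Submodule.finrank_mono fun X hX => Submodule.subset_span
    ⟨fun t => NormedSpace.exp (t • X), fun t => ?_, exp_zero_smul X,
      hasDerivAt_matrix.1 (hasDerivAt_exp_smul_zero X)⟩
  have h1 : star (NormedSpace.exp (t • X)) = NormedSpace.exp ((-t) • X) := by
    have e : star (t • X) = (-t) • X := by
      rw [show star (t • X) = -(t • X) from (spAlg n).smul_mem t hX, neg_smul]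
    rw [← e]
    let := NormedAlgebra.restrictScalars ℚ ℝ (Matrix (Fin n) (Fin n) ℍ[ℝ])
    exact NormedSpace.star_exp _
  have h2 : NormedSpace.exp (t • X) * star (NormedSpace.exp (t • X)) = 1 :=
    (congrArg _ h1).trans (exp_mul_exp_neg X t)
  exact ⟨mul_eq_one_comm.1 h2, h2⟩

lemma finrank_orbit_le {G : Set (Matrix (Fin n) (Fin n) ℍ[ℝ])} (hG : IsUnitaryGroup G)
    {k : Matrix (Fin n) (Fin n) ℍ[ℝ]} (hk : k ∈ SpSet n) :
    finrank ℝ (matTangentAt (lrOrbit G (diagSp1 n) k) k) ≤ finrank ℝ (lieAlg hG) + 3 * n := by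
  have hL := isUnitaryGroup_conjDiag hk
  have hle : matTangentAt (lrOrbit G (diagSp1 n) k) k
      ≤ (lieAlg hG ⊔ lieAlg hL).map (LinearMap.mulRight ℝ k) := by
    refine Submodule.span_le.2 ?_
    rintro w ⟨c, hc, hc0, hw⟩
    refine ⟨w * star k, mem_sup_lieAlg_of_curve hG hL isTraceForm_reTrace
      (p := fun t => c t * star k) (fun t => ?_) ?_ ((hasDerivAt_matrix.2 hw).mul_const _), ?_⟩
    · obtain ⟨g, hg, h, hh, e⟩ := hc t
      refine ⟨g, hg, k * star h * star k, ?_, ?_⟩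
      · change star k * (k * star h * star k) * k ∈ diagSp1 n
        have : star k * (k * star h * star k) * k = (star k * k) * star h * (star k * k) := by
          noncomm_ring
        rw [this, hk.1, one_mul, mul_one]
        exact isMatSubgroup_diagSp1.2.2 _ hh
      · simp only [e, mul_assoc]
    · simp only [hc0, hk.2]
    · rw [LinearMap.mulRight_apply, mul_assoc, hk.1, mul_one]
  calc _ ≤ _ := Submodule.finrank_mono hle
    _ ≤ _ := Submodule.finrank_map_le _ _
    _ ≤ _ := Submodule.finrank_add_le_finrank_add_finrank _ _
    _ ≤ _ := Nat.add_le_add_left (finrank_lieAlg_conjDiag hk) _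

/-- Second order condition at a maximum of the real trace on a coset of the full group. -/
lemma eq_zero_of_max {B X : Matrix (Fin n) (Fin n) ℍ[ℝ]} (hX : star X = -X) (hXB : X * B = -X)
    (hmax : ∀ s : ℝ, reTrace n (NormedSpace.exp (s • X) * B) ≤ reTrace n B) : X = 0 := by
  let σ : Matrix (Fin n) (Fin n) ℍ[ℝ] →L[ℝ] ℝ :=
    LinearMap.toContinuousLinearMap (reTrace n ∘ₗ LinearMap.mulRight ℝ B)
  let f : ℝ → ℝ := fun s => σ (NormedSpace.exp (s • X))
  have hf : ∀ s, HasDerivAt f (σ (NormedSpace.exp (s • X) * X)) s := fun s =>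
    σ.hasFDerivAt.comp_hasDerivAt s (hasDerivAt_exp_smul_const X s)
  have hf' : HasDerivAt (deriv f) (σ (X * X)) 0 := by
    rw [show deriv f = fun s => σ (NormedSpace.exp (s • X) * X) from funext fun s => (hf s).deriv]
    exact σ.hasFDerivAt.comp_hasDerivAt 0 ((hasDerivAt_exp_smul_zero X).mul_const X)
  have h2 : deriv (deriv f) 0 = reTrace n (star X * X) := by
    rw [hf'.deriv, hX]
    change reTrace n (X * X * B) = _
    rw [mul_assoc, hXB, mul_neg, neg_mul]
  have h0 : f 0 = reTrace n B := by
    refine (congrArg (fun Z => reTrace n (Z * B)) (exp_zero_smul X)).trans ?_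
    simp only [one_mul]
  have hlm : IsLocalMax f 0 := Eventually.of_forall fun s => by
    rw [h0]
    exact hmax s
  refine isTraceForm_reTrace.eq_zero X (not_lt.1 fun hpos => ?_)
  have hmin : IsLocalMin f 0 := isLocalMin_of_deriv_deriv_pos (h2 ▸ hpos) hlm.deriv_eq_zero
    (hf 0).continuousAt
  have hconst : f =ᶠ[𝓝 0] fun _ => f 0 := by
    filter_upwards [hlm, hmin] with s h1 h2 using h1.antisymm h2
  have h3 : deriv f =ᶠ[𝓝 0] deriv fun _ => f 0 := hconst.deriv
  have h4 : deriv (deriv f) 0 = 0 := by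
    rw [h3.deriv_eq]
    simp
  exact hpos.ne' (h2.symm.trans h4)

lemma eq_one_of_max {B : Matrix (Fin n) (Fin n) ℍ[ℝ]} (hB : B ∈ SpSet n)
    (hmax : ∀ X ∈ spAlg n, ∀ s : ℝ, reTrace n (NormedSpace.exp (s • X) * B) ≤ reTrace n B) :
    B = 1 := by
  have hsq : B * B = 1 := by
    refine isTraceForm_reTrace.eq_one ?_ ?_
    · rw [star_mul, mul_assoc, ← mul_assoc (star B) B, hB.1, one_mul, hB.1]
    · have hX : star B - B ∈ spAlg n := by
        rw [mem_spAlg, star_sub, star_star, neg_sub]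
      have h1 : HasDerivAt (fun s : ℝ => reTrace n (NormedSpace.exp (s • (star B - B)) * B))
          (reTrace n ((star B - B) * B)) 0 :=
        (LinearMap.toContinuousLinearMap (reTrace n)).hasFDerivAt.comp_hasDerivAt 0
          ((hasDerivAt_exp_smul_zero (star B - B)).mul_const B)
      have h2 := IsLocalMax.hasDerivAt_eq_zero (Eventually.of_forall fun s => by
        simpa using hmax _ hX s) h1
      rw [sub_mul, hB.1, map_sub] at h2
      linarith
  have hstar : star B = B := by
    rw [← mul_one (star B), ← hsq, ← mul_assoc, hB.1, one_mul]
  let P : Matrix (Fin n) (Fin n) ℍ[ℝ] := (2⁻¹ : ℝ) • (1 - B)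
  have hPs : star P = P := by
    change star ((2⁻¹ : ℝ) • (1 - B)) = (2⁻¹ : ℝ) • (1 - B)
    ext1 i j
    have h : star (1 - B) = 1 - B := by rw [star_sub, star_one, hstar]
    rw [Matrix.star_apply, Matrix.smul_apply, Matrix.smul_apply, quaternion_star_smul,
      ← Matrix.star_apply, h]
  have hPB : P * B = -P := by
    simp only [P, smul_mul_assoc, sub_mul, one_mul, hsq]
    rw [← smul_neg, neg_sub]
  have hPP : P * P = P := by
    nth_rw 2 [show P = (2⁻¹ : ℝ) • (1 - B) from rfl]
    rw [mul_smul_comm, mul_sub, mul_one, hPB, sub_neg_eq_add, ← two_smul ℝ P, smul_smul]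
    norm_num
  have hPDP : ∀ D ∈ spAlg n, P * D * P = 0 := fun D hD => by
    have hs : star (P * D * P) = -(P * D * P) := by
      rw [star_mul, star_mul, hPs, mem_spAlg.1 hD, neg_mul, mul_neg, mul_assoc]
    refine eq_zero_of_max (B := B) hs ?_ (hmax _ hs)
    rw [mul_assoc, hPB, mul_neg]
  have hdiag : ∀ j, P j j = 0 := fun j => by
    let a : ℍ[ℝ] := ⟨0, 1, 0, 0⟩
    have ha : a ≠ 0 := fun h => one_ne_zero (congrArg (fun q : ℍ[ℝ] => q.imI) h)
    have has : star a = -a := star_imH (mem_imH.2 rfl)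
    have hD : Matrix.single j j a ∈ spAlg n := by
      rw [mem_spAlg, Matrix.star_eq_conjTranspose, Matrix.conjTranspose_single, has,
        Matrix.single_neg]
    have h := congrFun (congrFun (hPDP _ hD) j) j
    simpa [Matrix.mul_apply, Matrix.single_apply, ite_and, ha] using h
  have hP : P = 0 := by
    refine isTraceForm_reTrace.eq_zero P ?_
    rw [hPs, hPP, reTrace_apply]
    simp [hdiag]
  have : (1 : Matrix (Fin n) (Fin n) ℍ[ℝ]) - B = 0 := by simpa [P] using hP
  exact (sub_eq_zero.1 this).symm

lemma eq_spSet_of_lieAlg_eq {G : Set (Matrix (Fin n) (Fin n) ℍ[ℝ])} (hGK : G ⊆ SpSet n)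
    (hG : IsUnitaryGroup G) (h : lieAlg hG = spAlg n) : G = SpSet n := by
  refine hGK.antisymm fun A hA => ?_
  have hc : Continuous fun g => reTrace n (g * A) :=
    (reTrace n).continuous_of_finiteDimensional.comp (continuous_mul_const A)
  obtain ⟨g, hg, hmax⟩ := hG.isCompact.exists_isMaxOn ⟨1, hG.one_mem⟩ hc.continuousOn
  have h1 : g * A = 1 := by
    refine eq_one_of_max (isMatSubgroup_spSet.2.1 _ (hGK hg) _ hA) fun X hX s => ?_
    rw [← mul_assoc]
    rw [← h] at hX
    exact hmax (hG.mul_mem _ (hX s) _ hg)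
  have h2 : A = star g := by
    rw [← one_mul A, ← hG.star_mul_self g hg, mul_assoc, h1, mul_one]
  rw [h2]
  exact hG.star_mem _ hg

end Matrices

end SpSubgroup

end

theorem statement10 (n : ℕ) (hn : 6 ≤ n)
    (G : Set (Matrix (Fin n) (Fin n) (Quaternion ℝ)))
    (hGK : G ⊆ SpSet n) (hgrp : IsMatSubgroup G) (hclosed : IsClosed G)
    (hconn : IsConnected G)
    (hcoh : lrCohomogeneity G (diagSp1 n) (SpSet n) ≤ 1) :
    G = SpSet n := by
  have hG := SpSubgroup.isUnitaryGroup_of_subset hGK hgrp hclosed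
  refine SpSubgroup.eq_spSet_of_lieAlg_eq hGK hG
    (SpSubgroup.eq_spAlg_of_finrank_le (SpSubgroup.isLieSubalg_lieAlg hG) hn ?_)
  have : Nonempty (SpSet n) := ⟨⟨1, SpSubgroup.isMatSubgroup_spSet.1⟩⟩
  have h1 := ciSup_le fun k : SpSet n => SpSubgroup.finrank_orbit_le hG k.2
  have h2 := SpSubgroup.finrank_spAlg_le_grpDim (n := n)
  unfold lrCohomogeneity at hcoh
  omega
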